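/- arXiv:1505.03576 — 8 statements merged into one kernel-verified Lean document; each statement's English description precedes it below -/
import Mathlib

section
/- Let n, m be integers with n > 2m and m ≥ 1. There exists a₀ > 0 such that for every real a with 0 < a < a₀, the set of nonzero complex solutions {z ∈ ℂ | z ≠ 0 ∧ conj(z)^m · (z^n − a^n) = z^(n−m)} is finite and has exactly 3n elements. -/
open Set in
/-- The numerator equation of the lens equation on the rays where `z ^ n` is positive. -/
lemma exists_unique_gt_one_pow_mul_pow_sub_one {k p : ℕ} (hp : p ≠ 0) {A : ℝ} (hA : 0 < A) :
    ∃ r₁ : ℝ, 1 < r₁ ∧ ∀ r : ℝ, 1 < r → (r ^ k * (r ^ p - 1) = A ↔ r = r₁) := by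
  have mono : StrictMonoOn (fun x : ℝ => x ^ k * (x ^ p - 1)) (Ici 1) := by
    intro x hx y hy hxy
    have hx1 : (1 : ℝ) ≤ x := hx
    have h1 : x ^ k ≤ y ^ k := pow_le_pow_left₀ (by linarith) hxy.le k
    have h2 : x ^ p < y ^ p := pow_lt_pow_left₀ hxy (by linarith) hp
    have h3 : 1 ≤ x ^ p := one_le_pow₀ hx1
    have h4 : 0 < y ^ k := pow_pos (by linarith) k
    exact mul_lt_mul' h1 (by linarith) (by linarith) h4
  have cont : ContinuousOn (fun x : ℝ => x ^ k * (x ^ p - 1)) (Icc 1 (1 + A)) := by fun_prop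
  have hbig : A ≤ (1 + A) ^ k * ((1 + A) ^ p - 1) := by
    have h1 : 1 ≤ (1 + A) ^ k := one_le_pow₀ (by linarith)
    have h2 : 1 + A ≤ (1 + A) ^ p := le_self_pow₀ (by linarith) hp
    nlinarith
  obtain ⟨r₁, hr₁, hval⟩ := intermediate_value_Icc (by linarith : (1 : ℝ) ≤ 1 + A) cont
    (show A ∈ Icc _ _ from ⟨by simpa using hA.le, hbig⟩)
  simp only at hval
  have hne : r₁ ≠ 1 := by
    rintro rfl
    simp at hval
    exact hA.ne hval
  refine ⟨r₁, lt_of_le_of_ne hr₁.1 hne.symm, fun r hr => ⟨fun h => ?_, fun h => h ▸ hval⟩⟩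
  exact mono.injOn hr.le hr₁.1 (h.trans hval.symm)

open Set in
/-- The numerator equation of the lens equation on the rays where `z ^ n` is negative. -/
lemma exists_two_lt_one_pow_mul_one_sub_pow {k p : ℕ} (hk : k ≠ 0) (hp : p ≠ 0) :
    ∃ M : ℝ, 0 < M ∧ M < 1 ∧ ∀ A : ℝ, 0 < A → A < M →
      ∃ r₂ r₃ : ℝ, 0 < r₂ ∧ r₂ < r₃ ∧ r₃ < 1 ∧
        ∀ r : ℝ, 0 < r → r < 1 → (r ^ k * (1 - r ^ p) = A ↔ r = r₂ ∨ r = r₃) := by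
  have hk0 : (0 : ℝ) < k := by positivity
  have hp0 : (0 : ℝ) < p := by positivity
  set g : ℝ → ℝ := fun x => x ^ k * (1 - x ^ p) with hg
  have hcont : Continuous g := by fun_prop
  have hderiv : ∀ x : ℝ, deriv g x = x ^ (k - 1) * (k - (k + p) * x ^ p) := by
    intro x
    have h : HasDerivAt g (k * x ^ (k - 1) * (1 - x ^ p) + x ^ k * -(p * x ^ (p - 1))) x :=
      (hasDerivAt_pow k x).mul ((hasDerivAt_pow p x).const_sub 1)
    rw [h.deriv]
    obtain ⟨i, rfl⟩ := Nat.exists_eq_succ_of_ne_zero hk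
    obtain ⟨j, rfl⟩ := Nat.exists_eq_succ_of_ne_zero hp
    simp only [Nat.succ_eq_add_one, Nat.add_sub_cancel]
    ring
  obtain ⟨ρ, hρ0, hρp⟩ : ∃ ρ : ℝ, 0 < ρ ∧ ρ ^ p = k / (k + p) :=
    ⟨((k : ℝ) / (k + p)) ^ ((p : ℝ)⁻¹), by positivity,
      Real.rpow_inv_natCast_pow (by positivity) hp⟩
  have hρp1 : ρ ^ p < 1 := by
    rw [hρp, div_lt_one (by positivity)]
    linarith
  have hρ1 : ρ < 1 := by
    by_contra! h
    exact absurd (one_le_pow₀ h (n := p)) (by linarith)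
  have hcrit : (k : ℝ) = (k + p) * ρ ^ p := by
    rw [hρp]
    field_simp
  have mono : StrictMonoOn g (Icc 0 ρ) := by
    refine strictMonoOn_of_deriv_pos (convex_Icc 0 ρ) hcont.continuousOn fun x hx => ?_
    rw [interior_Icc] at hx
    rw [hderiv]
    have h1 : x ^ p < ρ ^ p := pow_lt_pow_left₀ hx.2 hx.1.le hp
    have h2 : 0 < x ^ (k - 1) := pow_pos hx.1 _
    exact mul_pos h2 (by nlinarith)
  have anti : StrictAntiOn g (Icc ρ 1) := by
    refine strictAntiOn_of_deriv_neg (convex_Icc ρ 1) hcont.continuousOn fun x hx => ?_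
    rw [interior_Icc] at hx
    rw [hderiv]
    have h1 : ρ ^ p < x ^ p := pow_lt_pow_left₀ hx.1 hρ0.le hp
    have h2 : 0 < x ^ (k - 1) := pow_pos (hρ0.trans hx.1) _
    exact mul_neg_of_pos_of_neg h2 (by nlinarith)
  have g0 : g 0 = 0 := by simp [hg, hk]
  have g1 : g 1 = 0 := by simp [hg]
  refine ⟨g ρ, mul_pos (pow_pos hρ0 k) (by linarith), ?_, fun A hA hAM => ?_⟩
  · have h1 : ρ ^ k < 1 := pow_lt_one₀ hρ0.le hρ1 hk
    have h2 : 0 < ρ ^ p := pow_pos hρ0 p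
    have h3 : 0 < ρ ^ k := pow_pos hρ0 k
    simp only [hg]
    nlinarith
  obtain ⟨r₂, hr₂, hv₂⟩ := intermediate_value_Ioo hρ0.le hcont.continuousOn
    (show A ∈ Ioo (g 0) (g ρ) from ⟨by rwa [g0], hAM⟩)
  obtain ⟨r₃, hr₃, hv₃⟩ := intermediate_value_Ioo' hρ1.le hcont.continuousOn
    (show A ∈ Ioo (g 1) (g ρ) from ⟨by rwa [g1], hAM⟩)
  refine ⟨r₂, r₃, hr₂.1, hr₂.2.trans hr₃.1, hr₃.2, fun r hr0 hr1 => ⟨fun h => ?_, ?_⟩⟩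
  · rcases le_total r ρ with hle | hle
    · exact Or.inl (mono.injOn ⟨hr0.le, hle⟩ ⟨hr₂.1.le, hr₂.2.le⟩ (h.trans hv₂.symm))
    · exact Or.inr (anti.injOn ⟨hle, hr1.le⟩ ⟨hr₃.1.le, hr₃.2.le⟩ (h.trans hv₃.symm))
  · rintro (rfl | rfl)
    · exact hv₂
    · exact hv₃

lemma Complex.finite_and_ncard_setOf_pow_eq {n : ℕ} (hn : n ≠ 0) {w : ℂ} (hw : w ≠ 0) :
    {z : ℂ | z ^ n = w}.Finite ∧ {z : ℂ | z ^ n = w}.ncard = n := by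
  classical
  have hprim := Complex.isPrimitiveRoot_exp n hn
  have hset : {z : ℂ | z ^ n = w} = ((Polynomial.nthRoots n w).toFinset : Set ℂ) := by
    ext z
    simp [Polynomial.mem_nthRoots (Nat.pos_of_ne_zero hn)]
  rw [hset]
  refine ⟨Finset.finite_toSet _, ?_⟩
  rw [Set.ncard_coe_finset, Multiset.toFinset_card_of_nodup (hprim.nthRoots_nodup hw),
    hprim.card_nthRoots, if_pos]
  exact ⟨w ^ ((n : ℂ)⁻¹), Complex.cpow_nat_inv_pow w hn⟩

/-- Multiplying the lens equation by `z ^ m` leaves an equation in `z ^ n` and `‖z‖`. -/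
lemma lens_equation_iff {k m : ℕ} {z : ℂ} (hz : z ≠ 0) (A : ℂ) :
    (starRingEnd ℂ z) ^ m * (z ^ (k + 2 * m) - A) = z ^ (k + 2 * m - m) ↔
      ((‖z‖ ^ (2 * m) : ℝ) : ℂ) * (z ^ (k + 2 * m) - A) = z ^ (k + 2 * m) := by
  have hnorm : ((‖z‖ ^ (2 * m) : ℝ) : ℂ) = z ^ m * (starRingEnd ℂ z) ^ m := by
    rw [← mul_pow, Complex.mul_conj', pow_mul]
    push_cast
    rfl
  have hsplit : z ^ (k + 2 * m) = z ^ m * z ^ (k + 2 * m - m) := by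
    rw [← pow_add]
    congr 1
    omega
  rw [hnorm, mul_assoc]
  nth_rw 3 [hsplit]
  exact (mul_right_inj' (pow_ne_zero m hz)).symm

/-- The lens equation forces `z ^ n` to be real, of sign given by the side of the unit circle. -/
lemma norm_equation_iff {k p : ℕ} (hp : p ≠ 0) {A : ℝ} (hA : 0 < A) {z : ℂ} (hz : z ≠ 0) :
    ((‖z‖ ^ p : ℝ) : ℂ) * (z ^ (k + p) - (A : ℂ)) = z ^ (k + p) ↔
      (1 < ‖z‖ ∧ ‖z‖ ^ k * (‖z‖ ^ p - 1) = A ∧ z ^ (k + p) = ((‖z‖ ^ (k + p) : ℝ) : ℂ)) ∨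
      (‖z‖ < 1 ∧ ‖z‖ ^ k * (1 - ‖z‖ ^ p) = A ∧ z ^ (k + p) = ((-‖z‖ ^ (k + p) : ℝ) : ℂ)) := by
  have hr : 0 < ‖z‖ := norm_pos_iff.mpr hz
  have hw : ‖z ^ (k + p)‖ = ‖z‖ ^ (k + p) := norm_pow z _
  generalize z ^ (k + p) = w at hw ⊢
  generalize ‖z‖ = r at hr hw ⊢
  have hrp : 0 < r ^ p := pow_pos hr p
  constructor
  · intro h
    have hlin : w * ((r ^ p - 1 : ℝ) : ℂ) = ((A * r ^ p : ℝ) : ℂ) := by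
      push_cast at h ⊢
      linear_combination h
    have hne : r ^ p - 1 ≠ 0 := by
      intro h0
      rw [h0, Complex.ofReal_zero, mul_zero] at hlin
      exact (mul_pos hA hrp).ne (Complex.ofReal_injective (by simpa using hlin))
    obtain ⟨t, rfl⟩ : ∃ t : ℝ, w = t := by
      refine ⟨A * r ^ p / (r ^ p - 1), ?_⟩
      rw [Complex.ofReal_div, ← hlin, mul_div_cancel_right₀ _ (Complex.ofReal_ne_zero.mpr hne)]
    rw [Complex.norm_real, Real.norm_eq_abs] at hw
    have ht : t * (r ^ p - 1) = A * r ^ p := by exact_mod_cast hlin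
    have hpos : 0 < t * (r ^ p - 1) := ht ▸ mul_pos hA hrp
    rcases pos_and_pos_or_neg_and_neg_of_mul_pos hpos with ⟨ht0, hr1⟩ | ⟨ht0, hr1⟩
    · rw [abs_of_pos ht0] at hw
      subst hw
      refine Or.inl ⟨(one_lt_pow_iff_of_nonneg hr.le hp).mp (by linarith), ?_, rfl⟩
      refine mul_right_cancel₀ hrp.ne' ?_
      rw [← ht]
      ring
    · rw [abs_of_neg ht0] at hw
      obtain rfl : t = -r ^ (k + p) := by linarith
      refine Or.inr ⟨(pow_lt_one_iff_of_nonneg hr.le hp).mp (by linarith), ?_, rfl⟩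
      refine mul_right_cancel₀ hrp.ne' ?_
      rw [← ht]
      ring
  · rintro (⟨-, rfl, rfl⟩ | ⟨-, rfl, rfl⟩) <;> push_cast <;> ring

lemma norm_eq_of_pow_eq_ofReal {n : ℕ} (hn : n ≠ 0) {z : ℂ} {s r : ℝ} (hr : 0 ≤ r)
    (hs : |s| = r ^ n) (h : z ^ n = (s : ℂ)) : ‖z‖ = r := by
  refine (pow_left_inj₀ (norm_nonneg z) hr hn).mp ?_
  rw [← norm_pow, h, Complex.norm_real, Real.norm_eq_abs, hs]

/-- For integers `n > 2m`, `m ≥ 1`, there is `a₀ > 0` such that for all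
real `0 < a < a₀`, the set of nonzero solutions of the generalized lens equation
has exactly `3n` elements. -/
theorem stmt_2 (n m : ℕ) (hm : 1 ≤ m) (hnm : 2 * m < n) :
    ∃ a₀ : ℝ, 0 < a₀ ∧ ∀ a : ℝ, 0 < a → a < a₀ →
      ({z : ℂ | z ≠ 0 ∧ (starRingEnd ℂ z) ^ m * (z ^ n - (a : ℂ) ^ n) = z ^ (n - m)}).Finite ∧
      ({z : ℂ | z ≠ 0 ∧ (starRingEnd ℂ z) ^ m * (z ^ n - (a : ℂ) ^ n) = z ^ (n - m)}).ncard
        = 3 * n := by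
  obtain ⟨k, rfl⟩ : ∃ k, n = k + 2 * m := ⟨n - 2 * m, by omega⟩
  have hp : 2 * m ≠ 0 := by omega
  have hn : k + 2 * m ≠ 0 := by omega
  obtain ⟨M, hM0, hM1, hM⟩ := exists_two_lt_one_pow_mul_one_sub_pow (k := k) (by omega) hp
  refine ⟨M, hM0, fun a ha haM => ?_⟩
  have hA : 0 < a ^ (k + 2 * m) := pow_pos ha _
  have hAM : a ^ (k + 2 * m) < M :=
    (pow_le_of_le_one ha.le (haM.trans hM1).le hn).trans_lt haM
  obtain ⟨r₁, hr₁, h₁⟩ := exists_unique_gt_one_pow_mul_pow_sub_one (k := k) hp hA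
  obtain ⟨r₂, r₃, hr₂, hr₂₃, hr₃, h₂₃⟩ := hM _ hA hAM
  have hr₁0 : 0 < r₁ := one_pos.trans hr₁
  have hr₃0 : 0 < r₃ := hr₂.trans hr₂₃
  have hpow₁ : 0 < r₁ ^ (k + 2 * m) := pow_pos hr₁0 _
  have hpow₂ : 0 < r₂ ^ (k + 2 * m) := pow_pos hr₂ _
  have hpow₃ : 0 < r₃ ^ (k + 2 * m) := pow_pos hr₃0 _
  have hpow₂₃ : r₂ ^ (k + 2 * m) < r₃ ^ (k + 2 * m) := pow_lt_pow_left₀ hr₂₃ hr₂.le hn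
  have hset : {z : ℂ | z ≠ 0 ∧ (starRingEnd ℂ z) ^ m * (z ^ (k + 2 * m) - (a : ℂ) ^ (k + 2 * m))
        = z ^ (k + 2 * m - m)} =
      {z : ℂ | z ^ (k + 2 * m) = ((r₁ ^ (k + 2 * m) : ℝ) : ℂ)} ∪
      ({z : ℂ | z ^ (k + 2 * m) = ((-r₂ ^ (k + 2 * m) : ℝ) : ℂ)} ∪
        {z : ℂ | z ^ (k + 2 * m) = ((-r₃ ^ (k + 2 * m) : ℝ) : ℂ)}) := by
    ext z
    simp only [Set.mem_ofPred_eq, Set.mem_union]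
    constructor
    · rintro ⟨hz, h⟩
      have hr : 0 < ‖z‖ := norm_pos_iff.mpr hz
      rw [lens_equation_iff hz, ← Complex.ofReal_pow a, norm_equation_iff hp hA hz] at h
      rcases h with ⟨hlt, heq, hw⟩ | ⟨hlt, heq, hw⟩
      · rw [h₁ _ hlt] at heq
        exact Or.inl (heq ▸ hw)
      · rw [h₂₃ _ hr hlt] at heq
        exact Or.inr (heq.imp (fun e => by rwa [e] at hw) (fun e => by rwa [e] at hw))
    · intro h
      have hz : z ≠ 0 := by
        rintro rfl
        simp only [zero_pow hn, eq_comm (a := (0 : ℂ)), Complex.ofReal_eq_zero] at h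
        rcases h with h | h | h <;> linarith
      refine ⟨hz, ?_⟩
      rw [lens_equation_iff hz, ← Complex.ofReal_pow a, norm_equation_iff hp hA hz]
      rcases h with h | h | h
      · rw [norm_eq_of_pow_eq_ofReal hn hr₁0.le (abs_of_pos hpow₁) h]
        exact Or.inl ⟨hr₁, (h₁ _ hr₁).mpr rfl, h⟩
      · rw [norm_eq_of_pow_eq_ofReal hn hr₂.le (by rw [abs_neg, abs_of_pos hpow₂]) h]
        have hlt := hr₂₃.trans hr₃
        exact Or.inr ⟨hlt, (h₂₃ _ hr₂ hlt).mpr (Or.inl rfl), h⟩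
      · rw [norm_eq_of_pow_eq_ofReal hn hr₃0.le (by rw [abs_neg, abs_of_pos hpow₃]) h]
        exact Or.inr ⟨hr₃, (h₂₃ _ hr₃0 hr₃).mpr (Or.inr rfl), h⟩
  have fiber (s : ℝ) (hs : s ≠ 0) :=
    Complex.finite_and_ncard_setOf_pow_eq hn (Complex.ofReal_ne_zero.mpr hs)
  obtain ⟨f₁, c₁⟩ := fiber (r₁ ^ (k + 2 * m)) hpow₁.ne'
  obtain ⟨f₂, c₂⟩ := fiber (-r₂ ^ (k + 2 * m)) (by linarith)
  obtain ⟨f₃, c₃⟩ := fiber (-r₃ ^ (k + 2 * m)) (by linarith)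
  have disj (s t : ℝ) (hst : s ≠ t) :
      Disjoint {z : ℂ | z ^ (k + 2 * m) = (s : ℂ)} {z : ℂ | z ^ (k + 2 * m) = (t : ℂ)} :=
    Set.disjoint_left.mpr fun z hs ht =>
      hst (Complex.ofReal_injective (Eq.trans (Eq.symm hs) ht))
  rw [hset]
  refine ⟨f₁.union (f₂.union f₃), ?_⟩
  rw [Set.ncard_union_eq (Set.disjoint_union_right.mpr
      ⟨disj _ _ (by linarith), disj _ _ (by linarith)⟩) f₁ (f₂.union f₃),
    Set.ncard_union_eq (disj _ _ (by linarith)) f₂ f₃, c₁, c₂, c₃]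
  omega
end

section
/- Let n, m be integers with 2m ≥ n > m ≥ 1. There exists a₀ > 0 such that for every real a with 0 < a < a₀, the set of nonzero complex solutions {z ∈ ℂ | z ≠ 0 ∧ conj(z)^m · (z^n − a^n) = z^(n−m)} is finite and has exactly 2n elements. -/
open Polynomial in
lemma finite_ncard_setOf_pow_eq {n : ℕ} (hn : n ≠ 0) {c : ℂ} (hc : c ≠ 0) :
    {z : ℂ | z ^ n = c}.Finite ∧ {z : ℂ | z ^ n = c}.ncard = n := by
  have hprim := Complex.isPrimitiveRoot_exp n hn
  have hset : {z : ℂ | z ^ n = c} = ((nthRoots n c).toFinset : Set ℂ) := by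
    ext z
    simp [mem_nthRoots (Nat.pos_of_ne_zero hn)]
  rw [hset]
  refine ⟨Finset.finite_toSet _, ?_⟩
  rw [Set.ncard_coe_finset, Multiset.toFinset_card_of_nodup (hprim.nthRoots_nodup hc),
    hprim.card_nthRoots, if_pos (IsAlgClosed.exists_pow_nat_eq c (Nat.pos_of_ne_zero hn))]

lemma eq_of_pow_mul_pow_add_eq_one {n k : ℕ} (hn : n ≠ 0) {c x y : ℝ} (hx : 0 < x) (hy : 0 < y)
    (hxc : x ^ k * (x ^ n + c) = 1) (hyc : y ^ k * (y ^ n + c) = 1) : x = y := by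
  have key : ∀ u v : ℝ, 0 < u → u ^ k * (u ^ n + c) = 1 → v ^ k * (v ^ n + c) = 1 →
      ¬ u < v := by
    intro u v hu huc hvc huv
    have h₁ : u ^ n < v ^ n := pow_lt_pow_left₀ huv hu.le hn
    have h₂ : u ^ k ≤ v ^ k := pow_le_pow_left₀ hu.le huv.le k
    have h₃ : 0 < u ^ k := pow_pos hu k
    have h₄ : 0 < u ^ n + c := pos_of_mul_pos_right (huc ▸ one_pos) h₃.le
    nlinarith [mul_le_mul_of_nonneg_right h₂ (h₄.le.trans (by linarith : u ^ n + c ≤ v ^ n + c))]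
  exact le_antisymm (not_lt.mp (key y x hy hyc hxc)) (not_lt.mp (key x y hx hxc hyc))

lemma exists_pow_mul_pow_add_eq_one {n k : ℕ} (hn : n ≠ 0) {c : ℝ} (hc : |c| < 1) :
    ∃ r : ℝ, 0 < r ∧ r ^ k * (r ^ n + c) = 1 := by
  obtain ⟨hc₁, hc₂⟩ := abs_lt.mp hc
  have hcont : ContinuousOn (fun r : ℝ => r ^ k * (r ^ n + c)) (Set.Icc 0 2) := by fun_prop
  have h₀ : (0 : ℝ) ^ k * (0 ^ n + c) < 1 := by
    rcases Nat.eq_zero_or_pos k with rfl | hk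
    · simpa [hn] using hc₂
    · simp [hk.ne']
  have h₂ : (1 : ℝ) ≤ 2 ^ k * (2 ^ n + c) := by
    have h₃ : (1 : ℝ) ≤ 2 ^ k := one_le_pow₀ one_le_two
    have h₄ : (2 : ℝ) ≤ 2 ^ n := le_self_pow₀ one_le_two hn
    nlinarith
  obtain ⟨r, hr, hr'⟩ := intermediate_value_Icc zero_le_two hcont ⟨h₀.le, h₂⟩
  refine ⟨r, lt_of_le_of_ne hr.1 ?_, hr'⟩
  rintro rfl
  exact h₀.ne hr'

lemma lens_eq_iff {n m : ℕ} (hmn : m ≤ n) {z : ℂ} (hz : z ≠ 0) (c : ℂ) :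
    (starRingEnd ℂ z) ^ m * (z ^ n - c) = z ^ (n - m) ↔
      ((‖z‖ ^ (2 * m) - 1 : ℝ) : ℂ) * z ^ n = ((‖z‖ ^ (2 * m) : ℝ) : ℂ) * c := by
  have hnorm : z ^ m * (starRingEnd ℂ z) ^ m = (‖z‖ : ℂ) ^ (2 * m) := by
    rw [← mul_pow, Complex.mul_conj', pow_mul]
  have hpow : z ^ m * z ^ (n - m) = z ^ n := by rw [← pow_add, Nat.add_sub_cancel' hmn]
  rw [← mul_right_inj' (pow_ne_zero m hz), hpow, ← mul_assoc, hnorm]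
  push_cast
  constructor <;> intro h <;> linear_combination h

lemma lens_eq_iff_pow_eq {n m : ℕ} (hmn : m < n) (hn : n ≤ 2 * m) {c r s : ℝ}
    (hc : c ≠ 0) (hr : 0 < r) (hrc : r ^ (2 * m - n) * (r ^ n + -c) = 1)
    (hs : 0 < s) (hsc : s ^ (2 * m - n) * (s ^ n + c) = 1) (z : ℂ) :
    (z ≠ 0 ∧ (starRingEnd ℂ z) ^ m * (z ^ n - (c : ℂ)) = z ^ (n - m)) ↔
      z ^ n = ((r ^ n : ℝ) : ℂ) ∨ z ^ n = ((-s ^ n : ℝ) : ℂ) := by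
  obtain ⟨k, hk⟩ := Nat.exists_eq_add_of_le' hn
  have hn₀ : n ≠ 0 := (Nat.zero_lt_of_lt hmn).ne'
  rw [hk, Nat.add_sub_cancel] at hrc hsc
  constructor
  · rintro ⟨hz, h⟩
    rw [lens_eq_iff hmn.le hz, hk] at h
    have hz' : 0 < ‖z‖ := norm_pos_iff.mpr hz
    have hzn : ‖z‖ ^ n ≠ 0 := (pow_pos hz' n).ne'
    have hne : ‖z‖ ^ (k + n) - 1 ≠ 0 := by
      intro h₀
      rw [h₀, Complex.ofReal_zero, zero_mul, ← Complex.ofReal_mul] at h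
      exact mul_ne_zero (pow_pos hz' _).ne' hc (Complex.ofReal_eq_zero.mp h.symm)
    obtain ⟨t, ht⟩ : ∃ t : ℝ, z ^ n = t := by
      refine ⟨‖z‖ ^ (k + n) * c / (‖z‖ ^ (k + n) - 1), ?_⟩
      have hne' : (((‖z‖ ^ (k + n) - 1 : ℝ)) : ℂ) ≠ 0 := by exact_mod_cast hne
      rw [Complex.ofReal_div, eq_div_iff hne', mul_comm, h, Complex.ofReal_mul]
    have habs : |t| = ‖z‖ ^ n := by
      rw [← norm_pow, ht, Complex.norm_real, Real.norm_eq_abs]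
    rw [ht] at h ⊢
    norm_cast at h ⊢
    rcases abs_choice t with ht' | ht' <;> rw [ht'] at habs
    · left
      rw [habs] at h ⊢
      congr 1
      refine eq_of_pow_mul_pow_add_eq_one (k := k) hn₀ hz' hr ?_ hrc
      refine mul_right_cancel₀ hzn ?_
      linear_combination h
    · right
      obtain rfl : t = -‖z‖ ^ n := by linarith
      congr 2
      refine eq_of_pow_mul_pow_add_eq_one (k := k) hn₀ hz' hs ?_ hsc
      refine mul_right_cancel₀ hzn ?_
      linear_combination -h
  · intro h
    have hz : z ≠ 0 := by
      rintro rfl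
      have := pow_pos hr n
      have := pow_pos hs n
      rw [zero_pow hn₀] at h
      norm_cast at h
      rcases h with h | h <;> linarith
    refine ⟨hz, ?_⟩
    rw [lens_eq_iff hmn.le hz, hk]
    rcases h with h | h
    · have hzr : ‖z‖ = r := by
        rw [← pow_left_inj₀ (norm_nonneg z) hr.le hn₀, ← norm_pow, h, Complex.norm_real,
          Real.norm_eq_abs, abs_of_pos (pow_pos hr n)]
      rw [h, hzr]
      norm_cast
      linear_combination r ^ n * hrc
    · have hzs : ‖z‖ = s := by
        rw [← pow_left_inj₀ (norm_nonneg z) hs.le hn₀, ← norm_pow, h, Complex.norm_real,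
          Real.norm_eq_abs, abs_neg, abs_of_pos (pow_pos hs n)]
      rw [h, hzs]
      norm_cast
      linear_combination -s ^ n * hsc

/-- For integers `2m ≥ n > m ≥ 1`, there is `a₀ > 0` such that for all
real `0 < a < a₀`, the set of nonzero solutions of the generalized lens equation
has exactly `2n` elements. -/
theorem stmt_3 (n m : ℕ) (hm : 1 ≤ m) (hmn : m < n) (hn : n ≤ 2 * m) :
    ∃ a₀ : ℝ, 0 < a₀ ∧ ∀ a : ℝ, 0 < a → a < a₀ →
      ({z : ℂ | z ≠ 0 ∧ (starRingEnd ℂ z) ^ m * (z ^ n - (a : ℂ) ^ n) = z ^ (n - m)}).Finite ∧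
      ({z : ℂ | z ≠ 0 ∧ (starRingEnd ℂ z) ^ m * (z ^ n - (a : ℂ) ^ n) = z ^ (n - m)}).ncard
        = 2 * n := by
  refine ⟨1, one_pos, fun a ha ha₁ => ?_⟩
  have hn₀ : n ≠ 0 := (Nat.zero_lt_of_lt hmn).ne'
  have hc : |a ^ n| < 1 := by
    rw [abs_of_pos (pow_pos ha n)]
    exact pow_lt_one₀ ha.le ha₁ hn₀
  obtain ⟨r, hr, hrc⟩ :=
    exists_pow_mul_pow_add_eq_one (k := 2 * m - n) hn₀ ((abs_neg (a ^ n)).trans_lt hc)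
  obtain ⟨s, hs, hsc⟩ := exists_pow_mul_pow_add_eq_one (k := 2 * m - n) hn₀ hc
  have hrn := pow_pos hr n
  have hsn := pow_pos hs n
  have hset : {z : ℂ | z ≠ 0 ∧ (starRingEnd ℂ z) ^ m * (z ^ n - (a : ℂ) ^ n) = z ^ (n - m)} =
      {z : ℂ | z ^ n = ((r ^ n : ℝ) : ℂ)} ∪ {z : ℂ | z ^ n = ((-s ^ n : ℝ) : ℂ)} := by
    ext z
    simpa using lens_eq_iff_pow_eq hmn hn (pow_pos ha n).ne' hr hrc hs hsc z
  obtain ⟨hf₁, hc₁⟩ := finite_ncard_setOf_pow_eq hn₀ (Complex.ofReal_ne_zero.mpr hrn.ne')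
  obtain ⟨hf₂, hc₂⟩ :=
    finite_ncard_setOf_pow_eq hn₀ (Complex.ofReal_ne_zero.mpr (neg_neg_of_pos hsn).ne)
  have hdisj : Disjoint {z : ℂ | z ^ n = ((r ^ n : ℝ) : ℂ)}
      {z : ℂ | z ^ n = ((-s ^ n : ℝ) : ℂ)} := by
    refine Set.disjoint_left.mpr fun z h₁ h₂ => ?_
    have h₃ : r ^ n = -s ^ n := Complex.ofReal_injective (h₁.symm.trans h₂)
    linarith
  rw [hset]
  exact ⟨hf₁.union hf₂, by rw [Set.ncard_union_eq hdisj hf₁ hf₂, hc₁, hc₂, two_mul]⟩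
end

section
/- Let n > m ≥ 1 be integers, a > 0 and ε > 0 real numbers. If z ∈ ℂ satisfies z^m · conj(z)^m · (z^n − a^n) = z^n + ε·(z^n − a^n), then z ≠ 0 and z^(2n) is a positive real number; moreover, the set of such solutions is stable under multiplication by any n-th root of unity ζ (ζ^n = 1). -/
/-- For integers `n > m ≥ 1` and reals `a, ε > 0`, any solution `z` of the
bifurcated lens equation `z^m * conj(z)^m * (z^n - a^n) = z^n + ε (z^n - a^n)` is nonzero
and `z^(2n)` is a positive real number; moreover the solution set is stable under
multiplication by `n`-th roots of unity. -/
theorem stmt_4 (n m : ℕ) (hm : 1 ≤ m) (hnm : m < n) (a ε : ℝ) (ha : 0 < a) (hε : 0 < ε) :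
    (∀ z : ℂ,
      z ^ m * (starRingEnd ℂ z) ^ m * (z ^ n - (a : ℂ) ^ n)
        = z ^ n + (ε : ℂ) * (z ^ n - (a : ℂ) ^ n) →
      z ≠ 0 ∧ ∃ r : ℝ, 0 < r ∧ z ^ (2 * n) = (r : ℂ)) ∧
    (∀ z ζ : ℂ, ζ ^ n = 1 →
      z ^ m * (starRingEnd ℂ z) ^ m * (z ^ n - (a : ℂ) ^ n)
        = z ^ n + (ε : ℂ) * (z ^ n - (a : ℂ) ^ n) →
      (ζ * z) ^ m * (starRingEnd ℂ (ζ * z)) ^ m * ((ζ * z) ^ n - (a : ℂ) ^ n)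
        = (ζ * z) ^ n + (ε : ℂ) * ((ζ * z) ^ n - (a : ℂ) ^ n)) := by
  have ha' : (a : ℂ) ^ n ≠ 0 := pow_ne_zero _ (Complex.ofReal_ne_zero.2 ha.ne')
  have hε' : (ε : ℂ) ≠ 0 := Complex.ofReal_ne_zero.2 hε.ne'
  have hm0 : m ≠ 0 := by lia
  have hn0 : n ≠ 0 := by lia
  refine ⟨fun z h => ?_, fun z ζ hζ h => ?_⟩
  · have hz : z ≠ 0 := by
      rintro rfl
      simp [hm0, hn0, hε', ha.ne'] at h
    refine ⟨hz, ?_⟩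
    rw [← mul_pow, Complex.mul_conj] at h
    set t : ℝ := Complex.normSq z ^ m with ht
    have hw : ((t - 1 - ε : ℝ) : ℂ) * z ^ n = ((t - ε : ℝ) : ℂ) * (a : ℂ) ^ n := by
      rw [ht]
      push_cast
      linear_combination h
    have hd : t - 1 - ε ≠ 0 := by
      intro h0
      have h1 : t - ε = 1 := by linarith
      rw [h0, h1] at hw
      exact ha' (by simpa using hw.symm)
    have hw' : z ^ n = (((t - ε) * a ^ n / (t - 1 - ε) : ℝ) : ℂ) := by
      rw [Complex.ofReal_div, eq_div_iff (Complex.ofReal_ne_zero.2 hd), mul_comm, hw]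
      push_cast
      rfl
    refine ⟨((t - ε) * a ^ n / (t - 1 - ε)) ^ 2, ?_, ?_⟩
    · refine sq_pos_of_ne_zero fun h0 => pow_ne_zero n hz ?_
      rw [hw', h0, Complex.ofReal_zero]
    · rw [mul_comm, pow_mul, hw', Complex.ofReal_pow]
  · have hc : ζ * starRingEnd ℂ ζ = 1 := by
      rw [Complex.mul_conj, Complex.normSq_eq_norm_sq, Complex.norm_eq_one_of_pow_eq_one hζ hn0]
      simp
    have hcm : ζ ^ m * starRingEnd ℂ ζ ^ m = 1 := by rw [← mul_pow, hc, one_pow]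
    rw [map_mul, mul_pow ζ z n, hζ, one_mul, ← h]
    linear_combination (z ^ m * starRingEnd ℂ z ^ m * (z ^ n - (a : ℂ) ^ n)) * hcm
end

section
/- Let n, m be integers with n > 2m and m ≥ 1. There exists a₀ > 0 such that for every real a with 0 < a < a₀ there exists ε₀ > 0 such that for every real ε with 0 < ε < ε₀, the set {z ∈ ℂ | z^m · conj(z)^m · (z^n − a^n) = z^n + ε·(z^n − a^n)} is finite and has exactly 5n elements (equivalently, 5(n₁ − m) elements where n₁ = n + m). -/
open Polynomial in
/-- A nonzero complex number has exactly `n` distinct `n`-th roots. -/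
lemma card_nthRootsFinset_complex {n : ℕ} (hn : 0 < n) {w : ℂ} (hw : w ≠ 0) :
    (nthRootsFinset n w).card = n := by
  have hζ := Complex.isPrimitiveRoot_exp n hn.ne'
  classical
  rw [nthRootsFinset_def, Multiset.toFinset_card_of_nodup (hζ.nthRoots_nodup hw), hζ.card_nthRoots,
    if_pos]
  exact IsAlgClosed.exists_pow_nat_eq w hn

open Polynomial in
/-- The preimage of a finite set of nonzero complex numbers under `z ↦ z ^ n`. -/
lemma finite_and_ncard_pow_preimage {n : ℕ} (hn : 0 < n) (W : Finset ℂ) (hW : ∀ w ∈ W, w ≠ 0) :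
    {z : ℂ | z ^ n ∈ W}.Finite ∧ {z : ℂ | z ^ n ∈ W}.ncard = W.card * n := by
  classical
  have hset : {z : ℂ | z ^ n ∈ W} = ↑(W.biUnion fun w => nthRootsFinset n w) := by
    ext z
    simp [mem_nthRootsFinset hn]
  rw [hset]
  refine ⟨Finset.finite_toSet _, ?_⟩
  rw [Set.ncard_coe_finset, Finset.card_biUnion, Finset.sum_congr rfl, Finset.sum_const,
    smul_eq_mul]
  · exact fun w hw => card_nthRootsFinset_complex hn (hW w hw)
  · intro w _ w' _ hne
    refine Finset.disjoint_left.2 ?_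
    intro z hz hz'
    rw [mem_nthRootsFinset hn] at hz hz'
    exact hne (hz.symm.trans hz')

/-- The set of positive zeros of a real function. -/
def posZeros (f : ℝ → ℝ) : Set ℝ := {x | 0 < x ∧ f x = 0}

/-- Rolle's theorem for positive zeros, when the derivative is a monomial multiple of `g`. -/
lemma encard_posZeros_le_succ {f g : ℝ → ℝ} {j k : ℕ}
    (hf : ∀ x, HasDerivAt f (x ^ j * g x) x) (hg : (posZeros g).encard ≤ k) :
    (posZeros f).encard ≤ (k + 1 : ℕ) := by
  by_contra! h
  have h' : ((k + 2 : ℕ) : ℕ∞) ≤ (posZeros f).encard := by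
    have := Order.add_one_le_of_lt h
    exact_mod_cast this
  obtain ⟨t, htf, ht⟩ := Set.exists_subset_encard_eq h'
  have htfin : t.Finite := Set.finite_of_encard_eq_coe ht
  lift t to Finset ℝ using htfin
  rw [Set.encard_coe_eq_coe_finsetCard, Nat.cast_inj] at ht
  let e := t.orderEmbOfFin ht
  have hz (i) : 0 < e i ∧ f (e i) = 0 := htf (t.orderEmbOfFin_mem ht i)
  have hR (i : Fin (k + 1)) : ∃ c ∈ Set.Ioo (e i.castSucc) (e i.succ), c ^ j * g c = 0 :=
    exists_hasDerivAt_eq_zero (e.strictMono i.castSucc_lt_succ)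
      (fun x _ => (hf x).continuousAt.continuousWithinAt)
      ((hz _).2.trans (hz _).2.symm) (fun x _ => hf x)
  choose c hc hgc using hR
  have hmono : StrictMono c := by
    refine Fin.strictMono_iff_lt_succ.2 fun i => (hc _).2.trans ?_
    rw [Fin.succ_castSucc]
    exact (hc i.succ).1
  have hsub : Set.range c ⊆ posZeros g := by
    rintro _ ⟨i, rfl⟩
    have hpos := (hz i.castSucc).1.trans (hc i).1
    exact ⟨hpos, (mul_eq_zero.1 (hgc i)).resolve_left (pow_pos hpos j).ne'⟩
  have := (Set.encard_le_encard hsub).trans hg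
  rw [← Set.image_univ, hmono.injective.encard_image, Set.encard_univ] at this
  simp only [ENat.card_eq_coe_fintype_card, Fintype.card_fin, Nat.cast_le] at this
  omega

lemma encard_posZeros_binomial_le {c₀ c₁ : ℝ} {p : ℕ} (hp : 0 < p) (h₁ : c₁ ≠ 0) :
    (posZeros fun x => c₀ + c₁ * x ^ p).encard ≤ (1 : ℕ) := by
  rw [Nat.cast_one, Set.encard_le_one_iff]
  rintro x y ⟨hx, hx0⟩ ⟨hy, hy0⟩
  refine (pow_left_inj₀ hx.le hy.le hp.ne').1 (mul_left_cancel₀ h₁ ?_)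
  linarith

lemma hasDerivAt_monomial {p : ℕ} (c x : ℝ) :
    HasDerivAt (fun x => c * x ^ p) (c * (p * x ^ (p - 1))) x :=
  (hasDerivAt_pow p x).const_mul c

lemma encard_posZeros_trinomial_le {c₀ c₁ c₂ : ℝ} {p q : ℕ} (hp : 0 < p) (hq : 0 < q)
    (h₂ : c₂ ≠ 0) :
    (posZeros fun x => c₀ + c₁ * x ^ p + c₂ * x ^ (p + q)).encard ≤ (2 : ℕ) := by
  refine encard_posZeros_le_succ (j := p - 1) (fun x => ?_)
    (encard_posZeros_binomial_le (c₀ := c₁ * p) (c₁ := c₂ * (p + q : ℕ)) hq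
      (mul_ne_zero h₂ (by positivity)))
  refine (((hasDerivAt_monomial c₁ x).const_add c₀).add (hasDerivAt_monomial c₂ x)).congr_deriv ?_
  obtain ⟨p, rfl⟩ : ∃ r, p = r + 1 := ⟨p - 1, by omega⟩
  rw [show p + 1 + q - 1 = p + q by omega, Nat.add_sub_cancel]
  ring

/-- A trinomial with negative constant and positive leading coefficient has at most one positive zero. -/
lemma encard_posZeros_trinomial_le_one {c₀ c₁ c₂ : ℝ} {p q : ℕ} (h₀ : c₀ < 0) (h₂ : 0 < c₂)
    (hq : 0 < q) :
    (posZeros fun x => c₀ + c₁ * x ^ p + c₂ * x ^ (p + q)).encard ≤ (1 : ℕ) := by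
  rw [Nat.cast_one, Set.encard_le_one_iff]
  have key : ∀ x y : ℝ, 0 < x → x < y → c₀ + c₁ * x ^ p + c₂ * x ^ (p + q) = 0 →
      c₀ + c₁ * y ^ p + c₂ * y ^ (p + q) ≠ 0 := by
    intro x y hx hxy hx0 hy0
    have hxp := pow_pos hx p
    have hpow : x ^ q < y ^ q := pow_lt_pow_left₀ hxy hx.le hq.ne'
    have hpow' : x ^ p ≤ y ^ p := pow_le_pow_left₀ hx.le hxy.le p
    rw [pow_add] at hx0 hy0
    have hfac : 0 < c₁ + c₂ * x ^ q := by
      refine pos_of_mul_pos_right (a := x ^ p) ?_ hxp.le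
      nlinarith
    have hfac' : c₁ + c₂ * x ^ q < c₁ + c₂ * y ^ q := by gcongr
    have := mul_lt_mul' hpow' hfac' hfac.le (hxp.trans_le hpow')
    linarith
  rintro x y ⟨hx, hx0⟩ ⟨hy, hy0⟩
  rcases lt_trichotomy x y with h | h | h
  · exact absurd hy0 (key x y hx h hx0)
  · exact h
  · exact absurd hx0 (key y x hy h hy0)

lemma encard_posZeros_quadrinomial_le_succ {c₀ c₁ c₂ c₃ : ℝ} {p q r k : ℕ} (hp : 0 < p)
    (h : (posZeros fun x => c₁ * p + c₂ * (p + q : ℕ) * x ^ q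
      + c₃ * (p + q + r : ℕ) * x ^ (q + r)).encard ≤ k) :
    (posZeros fun x => c₀ + c₁ * x ^ p + c₂ * x ^ (p + q) + c₃ * x ^ (p + q + r)).encard
      ≤ (k + 1 : ℕ) := by
  refine encard_posZeros_le_succ (j := p - 1) (fun x => ?_) h
  refine ((((hasDerivAt_monomial c₁ x).const_add c₀).add (hasDerivAt_monomial c₂ x)).add
    (hasDerivAt_monomial c₃ x)).congr_deriv ?_
  obtain ⟨p, rfl⟩ : ∃ r, p = r + 1 := ⟨p - 1, by omega⟩
  rw [show p + 1 + q - 1 = p + q by omega, show p + 1 + q + r - 1 = p + q + r by omega,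
    Nat.add_sub_cancel]
  ring

/-- The solutions of the lens equation are the `z` for which `z ^ n` is `-r ^ n` or `r ^ n`, where
`r` is a positive zero of the corresponding real polynomial. -/
lemma lens_equation_iff_s5 {n m : ℕ} (hn : 0 < n) (hm : 0 < m) {A ε : ℝ} (hA : 0 < A) (hε : 0 < ε)
    (z : ℂ) :
    z ^ m * (starRingEnd ℂ z) ^ m * (z ^ n - A) = z ^ n + ε * (z ^ n - A) ↔
      (∃ r : ℝ, 0 < r ∧ r ^ n * (1 + ε - r ^ (2 * m)) - A * (r ^ (2 * m) - ε) = 0 ∧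
        z ^ n = ((-r ^ n : ℝ) : ℂ)) ∨
      (∃ r : ℝ, 0 < r ∧ r ^ n * (r ^ (2 * m) - 1 - ε) - A * (r ^ (2 * m) - ε) = 0 ∧
        z ^ n = ((r ^ n : ℝ) : ℂ)) := by
  have hs : z ^ m * (starRingEnd ℂ z) ^ m = ((‖z‖ ^ (2 * m) : ℝ) : ℂ) := by
    rw [← mul_pow, Complex.mul_conj', pow_mul]
    push_cast
    rfl
  rw [hs]
  have hnorm {r : ℝ} (hr : 0 < r) (h : ‖z ^ n‖ = r ^ n) : ‖z‖ = r := by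
    rw [norm_pow] at h
    exact (pow_left_inj₀ (norm_nonneg z) hr.le hn.ne').1 h
  constructor
  · intro h
    set s := ‖z‖ ^ (2 * m) with hsdef
    have h1 : z ^ n * ((s - 1 - ε : ℝ) : ℂ) = ((A * (s - ε) : ℝ) : ℂ) := by
      push_cast
      linear_combination h
    have hs1 : s - 1 - ε ≠ 0 := by
      intro h0
      rw [h0, Complex.ofReal_zero, mul_zero, eq_comm, Complex.ofReal_eq_zero] at h1
      rcases mul_eq_zero.1 h1 with h2 | h2 <;> linarith
    obtain ⟨w, hw⟩ : ∃ w : ℝ, z ^ n = w := by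
      refine ⟨A * (s - ε) / (s - 1 - ε), ?_⟩
      rw [Complex.ofReal_div, eq_div_iff (by exact_mod_cast hs1), h1]
    have h2 : w * (s - 1 - ε) = A * (s - ε) := by
      rw [hw] at h1
      exact_mod_cast h1
    have hz : 0 < ‖z‖ := by
      rw [norm_pos_iff]
      rintro rfl
      have hw0 : w = 0 := by
        rw [zero_pow hn.ne'] at hw
        exact_mod_cast hw.symm
      have hs0 : s = 0 := by rw [hsdef, norm_zero, zero_pow (by omega)]
      rw [hw0, hs0] at h2
      nlinarith
    have habs : |w| = ‖z‖ ^ n := by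
      rw [← norm_pow, hw, Complex.norm_real, Real.norm_eq_abs]
    rcases abs_cases w with ⟨hw', -⟩ | ⟨hw', -⟩
    · refine Or.inr ⟨‖z‖, hz, ?_, ?_⟩
      · rw [← habs, hw', ← hsdef]; linarith
      · rw [← habs, hw', hw]
    · refine Or.inl ⟨‖z‖, hz, ?_, ?_⟩
      · rw [← habs, hw', ← hsdef]; linarith
      · rw [← habs, hw', hw, neg_neg]
  · rintro (⟨r, hr, h, hz⟩ | ⟨r, hr, h, hz⟩)
    · have hzr : ‖z‖ = r := hnorm hr (by
        rw [hz, Complex.norm_real, Real.norm_eq_abs, abs_neg, abs_of_pos (pow_pos hr n)])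
      rw [hz, hzr]
      norm_cast
      linarith
    · have hzr : ‖z‖ = r := hnorm hr (by
        rw [hz, Complex.norm_real, Real.norm_eq_abs, abs_of_pos (pow_pos hr n)])
      rw [hz, hzr]
      norm_cast
      linarith

lemma exists_zero_Ioo {f : ℝ → ℝ} (hf : Continuous f) {x y : ℝ} (hxy : x ≤ y)
    (h : f x < 0 ∧ 0 < f y ∨ 0 < f x ∧ f y < 0) : ∃ c, x < c ∧ c < y ∧ f c = 0 := by
  rcases h with h | h
  · obtain ⟨c, hc, hc0⟩ := intermediate_value_Ioo hxy hf.continuousOn h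
    exact ⟨c, hc.1, hc.2, hc0⟩
  · obtain ⟨c, hc, hc0⟩ := intermediate_value_Ioo' hxy hf.continuousOn h.symm
    exact ⟨c, hc.1, hc.2, hc0⟩

/-- The real polynomial governing the solutions with `z ^ n` negative has exactly three positive
zeros. -/
lemma encard_posZeros_neg_branch {n m : ℕ} (hm : 1 ≤ m) (hnm : 2 * m < n) {a : ℝ} (ha : 0 < a)
    (ha' : a < 1 / 2) :
    ∃ ε₀ : ℝ, 0 < ε₀ ∧ ∀ ε : ℝ, 0 < ε → ε < ε₀ → ε < 1 →
      (posZeros fun r => r ^ n * (1 + ε - r ^ (2 * m)) - a ^ n * (r ^ (2 * m) - ε)).encard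
        = 3 := by
  set A := a ^ n
  have hA : 0 < A := pow_pos ha n
  have hA2 : A < (1 / 2) ^ n := pow_lt_pow_left₀ ha' ha.le (by omega)
  have hA12 : A < 1 / 2 := hA2.trans_le (pow_le_of_le_one (by norm_num) (by norm_num) (by omega))
  have hsA : 0 < A ^ (2 * m) := pow_pos hA _
  have hAn : A ^ n ≤ A * A ^ (2 * m) := by
    rw [← pow_succ']
    exact pow_le_pow_of_le_one hA.le (by linarith) hnm
  have hAn0 : 0 < A ^ n := pow_pos hA n
  have hneg : 0 < A * A ^ (2 * m) - A ^ n * (1 - A ^ (2 * m)) := by nlinarith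
  refine ⟨(A * A ^ (2 * m) - A ^ n * (1 - A ^ (2 * m))) / (A ^ n + A), by positivity, ?_⟩
  intro ε hε hε₀ hε1
  rw [lt_div_iff₀ (by positivity)] at hε₀
  set f : ℝ → ℝ := fun r => r ^ n * (1 + ε - r ^ (2 * m)) - A * (r ^ (2 * m) - ε) with hf
  have hcont : Continuous f := by fun_prop
  have h0 : 0 < f 0 := by
    simp only [hf]
    rw [zero_pow (by omega), zero_pow (by omega)]
    nlinarith
  have hfA : f A < 0 := by simp only [hf]; linarith
  have hhalf : 0 < f (1 / 2) := by
    have hs : ((1 : ℝ) / 2) ^ (2 * m) ≤ 1 / 2 :=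
      pow_le_of_le_one (by norm_num) (by norm_num) (by omega)
    simp only [hf]
    have : (1 / 2 : ℝ) ^ n * (1 / 2) ≤ (1 / 2 : ℝ) ^ n * (1 + ε - (1 / 2) ^ (2 * m)) := by
      gcongr; linarith
    have : A * ((1 / 2 : ℝ) ^ (2 * m) - ε) ≤ A * (1 / 2) := by
      gcongr; linarith
    linarith
  have htwo : f 2 < 0 := by
    have hs : (2 : ℝ) ≤ 2 ^ (2 * m) := le_self_pow₀ (by norm_num) (by omega)
    have h2n : (0 : ℝ) < 2 ^ n := by positivity
    simp only [hf]
    nlinarith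
  obtain ⟨x, hx0, hxA, hx⟩ := exists_zero_Ioo hcont hA.le (Or.inr ⟨h0, hfA⟩)
  obtain ⟨y, hyA, hyh, hy⟩ := exists_zero_Ioo hcont hA12.le (Or.inl ⟨hfA, hhalf⟩)
  obtain ⟨t, hth, -, ht⟩ := exists_zero_Ioo hcont (by norm_num) (Or.inr ⟨hhalf, htwo⟩)
  apply le_antisymm
  · obtain ⟨d, rfl⟩ : ∃ d, n = 2 * m + d := ⟨n - 2 * m, by omega⟩
    have hfe : f = fun r => A * ε + -A * r ^ (2 * m) + (1 + ε) * r ^ (2 * m + d)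
        + -1 * r ^ (2 * m + d + 2 * m) := by
      funext r
      simp only [hf]
      ring
    rw [hfe]
    exact encard_posZeros_quadrinomial_le_succ (k := 2) (by omega)
      (encard_posZeros_trinomial_le (by omega) (by omega)
        (mul_ne_zero (by norm_num) (Nat.cast_ne_zero.2 (by omega))))
  · have hsub : ({x, y, t} : Set ℝ) ⊆ posZeros f := by
      rintro _ (rfl | rfl | rfl)
      · exact ⟨hx0, hx⟩
      · exact ⟨hA.trans hyA, hy⟩
      · exact ⟨by linarith, ht⟩
    refine le_trans (le_of_eq ?_) (Set.encard_le_encard hsub)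
    rw [Set.encard_eq_three.2 ⟨x, y, t, ?_, ?_, ?_, rfl⟩] <;> apply ne_of_lt <;> linarith

/-- The real polynomial governing the solutions with `z ^ n` positive has exactly two positive
zeros. -/
lemma encard_posZeros_pos_branch {n m : ℕ} (hm : 1 ≤ m) (hnm : 2 * m < n) {A ε : ℝ} (hA : 0 < A)
    (hA' : A < 1) (hε : 0 < ε) (hε1 : ε < 1) :
    (posZeros fun r => r ^ n * (r ^ (2 * m) - 1 - ε) - A * (r ^ (2 * m) - ε)).encard = 2 := by
  set f : ℝ → ℝ := fun r => r ^ n * (r ^ (2 * m) - 1 - ε) - A * (r ^ (2 * m) - ε) with hf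
  have hcont : Continuous f := by fun_prop
  have h0 : 0 < f 0 := by
    simp only [hf]
    rw [zero_pow (by omega), zero_pow (by omega)]
    nlinarith
  have hone : f 1 < 0 := by
    simp only [hf, one_pow]
    nlinarith
  have htwo : 0 < f 2 := by
    have hs : (2 : ℝ) ^ 2 ≤ 2 ^ (2 * m) := pow_le_pow_right₀ (by norm_num) (by omega)
    have h2n : (2 : ℝ) ^ 2 ≤ 2 ^ n := pow_le_pow_right₀ (by norm_num) (by omega)
    simp only [hf]
    have : (2 : ℝ) ^ 2 * (2 ^ (2 * m) - 1 - ε) ≤ 2 ^ n * (2 ^ (2 * m) - 1 - ε) := by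
      gcongr; linarith
    have : A * ((2 : ℝ) ^ (2 * m) - ε) ≤ 1 * (2 ^ (2 * m) - ε) := by
      gcongr; linarith
    linarith
  obtain ⟨x, hx0, hx1, hx⟩ := exists_zero_Ioo hcont zero_le_one (Or.inr ⟨h0, hone⟩)
  obtain ⟨y, hy1, -, hy⟩ := exists_zero_Ioo hcont one_le_two (Or.inl ⟨hone, htwo⟩)
  apply le_antisymm
  · obtain ⟨d, rfl⟩ : ∃ d, n = 2 * m + d := ⟨n - 2 * m, by omega⟩
    have hfe : f = fun r => A * ε + -A * r ^ (2 * m) + -(1 + ε) * r ^ (2 * m + d)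
        + 1 * r ^ (2 * m + d + 2 * m) := by
      funext r
      simp only [hf]
      ring
    rw [hfe]
    refine encard_posZeros_quadrinomial_le_succ (k := 1) (by omega)
      (encard_posZeros_trinomial_le_one ?_ ?_ (by omega))
    · exact mul_neg_of_neg_of_pos (by linarith) (by positivity)
    · positivity
  · have hsub : ({x, y} : Set ℝ) ⊆ posZeros f := by
      rintro _ (rfl | rfl)
      · exact ⟨hx0, hx⟩
      · exact ⟨by linarith, hy⟩
    refine le_trans (le_of_eq ?_) (Set.encard_le_encard hsub)
    rw [Set.encard_pair (hx1.trans hy1).ne]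


/-- For integers `n > 2m`, `m ≥ 1`, there exists `a₀ > 0` such that for every
`0 < a < a₀` there exists `ε₀ > 0` such that for every `0 < ε < ε₀`, the solution set of
the bifurcated lens equation has exactly `5n` elements. -/
theorem stmt_5 (n m : ℕ) (hm : 1 ≤ m) (hnm : 2 * m < n) :
    ∃ a₀ : ℝ, 0 < a₀ ∧ ∀ a : ℝ, 0 < a → a < a₀ →
      ∃ ε₀ : ℝ, 0 < ε₀ ∧ ∀ ε : ℝ, 0 < ε → ε < ε₀ →
        ({z : ℂ | z ^ m * (starRingEnd ℂ z) ^ m * (z ^ n - (a : ℂ) ^ n)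
            = z ^ n + (ε : ℂ) * (z ^ n - (a : ℂ) ^ n)}).Finite ∧
        ({z : ℂ | z ^ m * (starRingEnd ℂ z) ^ m * (z ^ n - (a : ℂ) ^ n)
            = z ^ n + (ε : ℂ) * (z ^ n - (a : ℂ) ^ n)}).ncard = 5 * n := by
  refine ⟨1 / 2, by norm_num, fun a ha ha' => ?_⟩
  obtain ⟨ε₀, hε₀, hneg⟩ := encard_posZeros_neg_branch hm hnm ha ha'
  refine ⟨min ε₀ 1, lt_min hε₀ one_pos, fun ε hε hlt => ?_⟩
  have hn : 0 < n := by omega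
  have hA : 0 < a ^ n := pow_pos ha n
  have hN := hneg ε hε (hlt.trans_le (min_le_left _ _)) (hlt.trans_le (min_le_right _ _))
  have hP := encard_posZeros_pos_branch hm hnm hA (pow_lt_one₀ ha.le (by linarith) hn.ne') hε
    (hlt.trans_le (min_le_right _ _))
  set N := posZeros fun r => r ^ n * (1 + ε - r ^ (2 * m)) - a ^ n * (r ^ (2 * m) - ε) with hNdef
  set P := posZeros fun r => r ^ n * (r ^ (2 * m) - 1 - ε) - a ^ n * (r ^ (2 * m) - ε) with hPdef
  set W : Set ℂ := (fun r : ℝ => ((-r ^ n : ℝ) : ℂ)) '' N ∪ (fun r : ℝ => ((r ^ n : ℝ) : ℂ)) '' P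
    with hWdef
  have hpow : Set.InjOn (fun r : ℝ => r ^ n) (Set.Ioi 0) := fun x hx y hy h =>
    (pow_left_inj₀ (le_of_lt hx) (le_of_lt hy) hn.ne').1 h
  have hWcard : W.encard = 5 := by
    rw [hWdef, Set.encard_union_eq, Set.InjOn.encard_image, Set.InjOn.encard_image, hN, hP]
    · norm_num
    · exact fun x hx y hy h => hpow hx.1 hy.1 (Complex.ofReal_injective h)
    · exact fun x hx y hy h => hpow hx.1 hy.1 (neg_injective (Complex.ofReal_injective h))
    · rw [Set.disjoint_left]
      rintro _ ⟨x, hx, rfl⟩ ⟨y, hy, h⟩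
      have h' : y ^ n = -x ^ n := Complex.ofReal_injective h
      have := pow_pos hx.1 n
      have := pow_pos hy.1 n
      linarith
  have hW0 : ∀ w ∈ W, w ≠ 0 := by
    rintro _ (⟨x, hx, rfl⟩ | ⟨x, hx, rfl⟩)
    · exact Complex.ofReal_ne_zero.2 (neg_ne_zero.2 (pow_pos hx.1 n).ne')
    · exact Complex.ofReal_ne_zero.2 (pow_pos hx.1 n).ne'
  have hset : {z : ℂ | z ^ m * (starRingEnd ℂ z) ^ m * (z ^ n - (a : ℂ) ^ n)
      = z ^ n + (ε : ℂ) * (z ^ n - (a : ℂ) ^ n)} = {z | z ^ n ∈ W} := by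
    ext z
    have := lens_equation_iff_s5 hn hm hA hε z
    rw [Complex.ofReal_pow] at this
    rw [Set.mem_ofPred_eq, this]
    simp only [hWdef, hNdef, hPdef, posZeros, Set.mem_ofPred_eq, Set.mem_union, Set.mem_image,
      and_assoc, eq_comm (b := z ^ n)]
  rw [hset]
  clear_value W
  lift W to Finset ℂ using Set.finite_of_encard_eq_coe (k := 5) hWcard
  rw [Set.encard_coe_eq_coe_finsetCard] at hWcard
  have hcard : W.card = 5 := by exact_mod_cast hWcard
  rw [← hcard]
  exact finite_and_ncard_pow_preimage hn W hW0
end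

section
/- Let m ≥ 1 be an integer and let p₀, q₀ be polynomials over ℂ with p₀(0) ≠ 0. If the set S = {w ∈ ℂ | conj(w) · q₀(w) = p₀(w)} is finite, then the set T = {z ∈ ℂ | conj(z)^m · q₀(z^m) = p₀(z^m)} is finite and its cardinality equals m times the cardinality of S. -/
/-- A nonzero complex number has exactly `m` distinct `m`-th roots. -/
theorem Complex.card_toFinset_nthRoots {m : ℕ} (hm : m ≠ 0) {w : ℂ} (hw : w ≠ 0) :
    (Polynomial.nthRoots m w).toFinset.card = m := by
  have hζ := Complex.isPrimitiveRoot_exp m hm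
  rw [Multiset.toFinset_card_of_nodup (hζ.nthRoots_nodup hw), hζ.card_nthRoots,
    if_pos (IsAlgClosed.exists_pow_nat_eq w (Nat.pos_of_ne_zero hm))]

/-- The preimage of a finite set of nonzero complex numbers under `z ↦ z ^ m` is finite, with `m`
times as many elements. -/
theorem Set.Finite.finite_and_ncard_preimage_pow {m : ℕ} (hm : m ≠ 0) {S : Set ℂ}
    (hS : S.Finite) (h0 : (0 : ℂ) ∉ S) :
    ((fun z : ℂ => z ^ m) ⁻¹' S).Finite ∧ ((fun z : ℂ => z ^ m) ⁻¹' S).ncard = m * S.ncard := by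
  have hpre : (fun z : ℂ => z ^ m) ⁻¹' S =
      ↑(hS.toFinset.biUnion fun w => (Polynomial.nthRoots m w).toFinset) := by
    ext z
    simp [Polynomial.mem_nthRoots (Nat.pos_of_ne_zero hm)]
  rw [hpre]
  refine ⟨Finset.finite_toSet _, ?_⟩
  rw [Set.ncard_coe_finset, Finset.card_biUnion, Set.ncard_eq_toFinset_card S hS,
    Finset.sum_const_nat (m := m), mul_comm]
  · intro w hw
    exact Complex.card_toFinset_nthRoots hm
      (ne_of_mem_of_not_mem (hS.mem_toFinset.mp hw) h0)
  · intro v _ w _ hvw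
    refine Finset.disjoint_left.mpr fun z hv hw => hvw ?_
    rw [Multiset.mem_toFinset, Polynomial.mem_nthRoots (Nat.pos_of_ne_zero hm)] at hv hw
    exact hv.symm.trans hw

/-- For `m ≥ 1` and polynomials `p₀, q₀` over `ℂ` with `p₀(0) ≠ 0`, if
`S = {w | conj(w) q₀(w) = p₀(w)}` is finite then
`T = {z | conj(z)^m q₀(z^m) = p₀(z^m)}` is finite with `#T = m * #S`. -/
theorem stmt_6 (m : ℕ) (hm : 1 ≤ m) (p₀ q₀ : Polynomial ℂ) (hp₀ : p₀.eval 0 ≠ 0)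
    (hS : ({w : ℂ | (starRingEnd ℂ w) * q₀.eval w = p₀.eval w}).Finite) :
    ({z : ℂ | (starRingEnd ℂ z) ^ m * q₀.eval (z ^ m) = p₀.eval (z ^ m)}).Finite ∧
    ({z : ℂ | (starRingEnd ℂ z) ^ m * q₀.eval (z ^ m) = p₀.eval (z ^ m)}).ncard
      = m * ({w : ℂ | (starRingEnd ℂ w) * q₀.eval w = p₀.eval w}).ncard := by
  simpa only [Set.preimage_ofPred_eq, map_pow] using
    hS.finite_and_ncard_preimage_pow (Nat.one_le_iff_ne_zero.mp hm)
      (by simpa using hp₀.symm)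
end

section
/- Let m ≥ 1 be an integer. The set {z ∈ ℂ | conj(z)^m · (z^(2m) − 1/2) = z^m − 1/30} is finite and has exactly 5m elements. -/
/-- The preimage under `z ↦ z ^ m` of a finite set of nonzero complex numbers. -/
lemma Complex.finite_and_ncard_pow_mem {m : ℕ} (hm : m ≠ 0) (T : Finset ℂ) (hT : (0 : ℂ) ∉ T) :
    {z : ℂ | z ^ m ∈ T}.Finite ∧ {z : ℂ | z ^ m ∈ T}.ncard = T.card * m := by
  classical
  have hpos : 0 < m := Nat.pos_of_ne_zero hm
  have hcoe : {z : ℂ | z ^ m ∈ T} =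
      (T.biUnion fun w => (Polynomial.nthRoots m w).toFinset : Finset ℂ) := by
    ext z
    simp [Polynomial.mem_nthRoots hpos]
  have hζ := Complex.isPrimitiveRoot_exp m hm
  rw [hcoe]
  refine ⟨Finset.finite_toSet _, ?_⟩
  rw [Set.ncard_coe_finset, Finset.card_biUnion]
  · refine Finset.sum_const_nat fun w hw => ?_
    have hw0 : w ≠ 0 := fun h => hT (h ▸ hw)
    rw [Multiset.toFinset_card_of_nodup (hζ.nthRoots_nodup hw0), hζ.card_nthRoots,
      if_pos (IsAlgClosed.exists_pow_nat_eq w hpos)]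
  · intro u _ v _ huv
    rw [Function.onFun, Finset.disjoint_left]
    intro z hu hv
    rw [Multiset.mem_toFinset, Polynomial.mem_nthRoots hpos] at hu hv
    exact huv (hu.symm.trans hv)

/-- The cubic `x³ - 3x/2 + 1/30` has exactly three real roots. -/
lemma exists_three_real_roots : ∃ a b c : ℝ, a < b ∧ b < c ∧
    ∀ x : ℝ, x ^ 3 - 3 / 2 * x + 1 / 30 = 0 ↔ x = a ∨ x = b ∨ x = c := by
  set p : ℝ → ℝ := fun x => x ^ 3 - 3 / 2 * x + 1 / 30 with hp
  have hc : Continuous p := by fun_prop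
  obtain ⟨a, ⟨_, ha⟩, ha0⟩ := intermediate_value_Ioo (by norm_num : (-2 : ℝ) ≤ 0)
    hc.continuousOn (show (0 : ℝ) ∈ Set.Ioo (p (-2)) (p 0) by norm_num [hp])
  obtain ⟨b, ⟨hb, hb'⟩, hb0⟩ := intermediate_value_Ioo' (by norm_num : (0 : ℝ) ≤ 1)
    hc.continuousOn (show (0 : ℝ) ∈ Set.Ioo (p 1) (p 0) by norm_num [hp])
  obtain ⟨c, ⟨hc', _⟩, hc0⟩ := intermediate_value_Ioo (by norm_num : (1 : ℝ) ≤ 2)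
    hc.continuousOn (show (0 : ℝ) ∈ Set.Ioo (p 1) (p 2) by norm_num [hp])
  simp only [hp] at ha0 hb0 hc0
  have hab : a < b := ha.trans hb
  have hbc : b < c := hb'.trans hc'
  refine ⟨a, b, c, hab, hbc, fun x => ⟨fun hx => ?_, ?_⟩⟩
  · have h1 : a ^ 2 + a * b + b ^ 2 = 3 / 2 :=
      mul_left_cancel₀ (sub_ne_zero.2 hab.ne) (by linear_combination ha0 - hb0)
    have h2 : b ^ 2 + b * c + c ^ 2 = 3 / 2 :=
      mul_left_cancel₀ (sub_ne_zero.2 hbc.ne) (by linear_combination hb0 - hc0)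
    have h3 : a + b + c = 0 :=
      mul_left_cancel₀ (sub_ne_zero.2 (hab.trans hbc).ne) (by linear_combination h1 - h2)
    obtain rfl : c = -a - b := by linarith
    have h : (x - a) * ((x - b) * (x - (-a - b))) = 0 := by
      linear_combination hx - ha0 + (a - x) * h1
    simpa [sub_eq_zero] using h
  · rintro (rfl | rfl | rfl) <;> assumption

/-- The lens equation in real coordinates: real solutions solve a cubic, and there are exactly two
nonreal ones. -/
lemma lens_equation_iff_s7 (w : ℂ) :
    (starRingEnd ℂ w) * (w ^ 2 - 1 / 2) = w - 1 / 30 ↔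
      (w.im = 0 ∧ w.re ^ 3 - 3 / 2 * w.re + 1 / 30 = 0) ∨
      (w.re = 1 / 30 ∧ (w.im = √(449 / 900) ∨ w.im = -√(449 / 900))) := by
  obtain ⟨x, y⟩ := w
  have hs : √(449 / 900 : ℝ) ^ 2 = 449 / 900 := Real.sq_sqrt (by norm_num)
  have key : (starRingEnd ℂ ⟨x, y⟩) * ((⟨x, y⟩ : ℂ) ^ 2 - 1 / 2) = ⟨x, y⟩ - 1 / 30 ↔
      (x ^ 2 + y ^ 2) * x - 3 / 2 * x + 1 / 30 = 0 ∧ y * (x ^ 2 + y ^ 2 - 1 / 2) = 0 := by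
    have h2 : (1 / 2 : ℂ) = ((1 / 2 : ℝ) : ℂ) := by push_cast; rfl
    have h30 : (1 / 30 : ℂ) = ((1 / 30 : ℝ) : ℂ) := by push_cast; rfl
    rw [h2, h30, Complex.ext_iff]
    simp only [pow_two, Complex.mul_re, Complex.mul_im, Complex.sub_re, Complex.sub_im,
      Complex.conj_re, Complex.conj_im, Complex.ofReal_re, Complex.ofReal_im]
    constructor <;> rintro ⟨h, h'⟩ <;> constructor <;> linarith
  rw [key, ← sq_eq_sq_iff_eq_or_eq_neg, hs]
  constructor
  · rintro ⟨h, h'⟩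
    rcases mul_eq_zero.1 h' with rfl | h'
    · exact .inl ⟨rfl, by linear_combination h⟩
    · obtain rfl : x = 1 / 30 := by linear_combination -h + x * h'
      exact .inr ⟨rfl, by linear_combination h'⟩
  · rintro (⟨rfl, h⟩ | ⟨rfl, h⟩)
    · exact ⟨by linear_combination h, zero_mul _⟩
    · exact ⟨by linear_combination h / 30, by linear_combination y * h⟩

/-- The lens equation has exactly five solutions, all of them nonzero. -/
lemma exists_finset_lens_solutions : ∃ T : Finset ℂ, T.card = 5 ∧ (0 : ℂ) ∉ T ∧
    ∀ w : ℂ, w ∈ T ↔ (starRingEnd ℂ w) * (w ^ 2 - 1 / 2) = w - 1 / 30 := by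
  classical
  obtain ⟨a, b, c, hab, hbc, h⟩ := exists_three_real_roots
  have hs : 0 < √(449 / 900 : ℝ) := Real.sqrt_pos.2 (by norm_num)
  set s := √(449 / 900 : ℝ) with hs_def
  have hT : ∀ w : ℂ, w ∈ ({⟨a, 0⟩, ⟨b, 0⟩, ⟨c, 0⟩, ⟨1 / 30, s⟩, ⟨1 / 30, -s⟩} : Finset ℂ) ↔
      (starRingEnd ℂ w) * (w ^ 2 - 1 / 2) = w - 1 / 30 := by
    intro w
    rw [lens_equation_iff_s7, h, ← hs_def]
    simp only [Finset.mem_insert, Finset.mem_singleton, Complex.ext_iff]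
    tauto
  refine ⟨_, ?_, ?_, hT⟩
  · have hss : s ≠ -s := by linarith
    repeat rw [Finset.card_insert_of_notMem]
    · simp
    all_goals simp [Complex.ext_iff, hab.ne, hbc.ne, (hab.trans hbc).ne, hs.ne, hs.ne', hss]
  · rw [hT]
    norm_num

/-- For `m ≥ 1`, the set of solutions of
`conj(z)^m (z^(2m) - 1/2) = z^m - 1/30` is finite with exactly `5m` elements. -/
theorem stmt_7 (m : ℕ) (hm : 1 ≤ m) :
    ({z : ℂ | (starRingEnd ℂ z) ^ m * (z ^ (2 * m) - 1 / 2) = z ^ m - 1 / 30}).Finite ∧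
    ({z : ℂ | (starRingEnd ℂ z) ^ m * (z ^ (2 * m) - 1 / 2) = z ^ m - 1 / 30}).ncard
      = 5 * m := by
  obtain ⟨T, hcard, h0, hT⟩ := exists_finset_lens_solutions
  have hset : {z : ℂ | (starRingEnd ℂ z) ^ m * (z ^ (2 * m) - 1 / 2) = z ^ m - 1 / 30} =
      {z : ℂ | z ^ m ∈ T} := by
    ext z
    rw [Set.mem_ofPred_eq, Set.mem_ofPred_eq, hT, map_pow, ← pow_mul, mul_comm m 2]
  rw [hset, ← hcard]
  exact Complex.finite_and_ncard_pow_mem (Nat.one_le_iff_ne_zero.1 hm) T h0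
end

section
/- Let n, m be integers with 2m ≥ n > m ≥ 1. There exists a₀ > 0 such that for every real a with 0 < a < a₀ there exists ε₀ > 0 such that for every real ε with 0 < ε < ε₀, the set {z ∈ ℂ | z^m · conj(z)^m · (z^n − a^n) = z^n + ε·(z^n − a^n)} is finite and has at least 3n elements (equivalently, at least 3(n₁ − m) where n₁ = n + m). -/
open Polynomial in
theorem card_nthRoots_toFinset_of_ne_zero {n : ℕ} (hn : n ≠ 0) {w : ℂ} (hw : w ≠ 0) :
    (nthRoots n w).toFinset.card = n := by
  have hζ := Complex.isPrimitiveRoot_exp n hn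
  rw [Multiset.toFinset_card_of_nodup (hζ.nthRoots_nodup hw), hζ.card_nthRoots,
    if_pos (IsAlgClosed.exists_pow_nat_eq w (Nat.pos_of_ne_zero hn))]

theorem pow_mul_conj_pow (z : ℂ) (m : ℕ) :
    z ^ m * (starRingEnd ℂ z) ^ m = ((‖z‖ ^ (2 * m) : ℝ) : ℂ) := by
  rw [← mul_pow, Complex.mul_conj', pow_mul]
  push_cast
  rfl

/-- If `r` solves the radial equation with sign `σ`, then every `z` with `z ^ n = σ * r ^ n` is a
solution of norm `r`. -/
theorem solution_of_radial {n m : ℕ} (hn : n ≠ 0) {A ε r σ : ℝ} (hr : 0 ≤ r) (hσ : |σ| = 1)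
    (h : σ * r ^ n * (r ^ (2 * m) - 1 - ε) = A * (r ^ (2 * m) - ε)) {z : ℂ}
    (hz : z ^ n = ((σ * r ^ n : ℝ) : ℂ)) :
    ‖z‖ = r ∧ z ^ m * (starRingEnd ℂ z) ^ m * (z ^ n - A) = z ^ n + ε * (z ^ n - A) := by
  have hnorm : ‖z‖ = r := by
    refine (pow_left_inj₀ (norm_nonneg z) hr hn).1 ?_
    rw [← norm_pow, hz, Complex.norm_real, Real.norm_eq_abs, abs_mul, hσ, one_mul,
      abs_of_nonneg (pow_nonneg hr n)]
  refine ⟨hnorm, ?_⟩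
  rw [pow_mul_conj_pow, hnorm, hz]
  norm_cast
  linear_combination h

theorem norm_eq_of_solution {n m : ℕ} {A ε : ℝ} {z : ℂ}
    (h : z ^ m * (starRingEnd ℂ z) ^ m * (z ^ n - A) = z ^ n + ε * (z ^ n - A)) :
    z ^ n * ((‖z‖ ^ (2 * m) - 1 - ε : ℝ) : ℂ) = ((A * (‖z‖ ^ (2 * m) - ε) : ℝ) : ℂ) := by
  rw [pow_mul_conj_pow] at h
  push_cast at h ⊢
  linear_combination h

open Polynomial in
theorem finite_solutions {n m : ℕ} (hn : n ≠ 0) (hm : m ≠ 0) {A ε : ℝ} (hA : A ≠ 0) (hε : ε ≠ 0) :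
    {z : ℂ | z ^ m * (starRingEnd ℂ z) ^ m * (z ^ n - A) = z ^ n + ε * (z ^ n - A)}.Finite := by
  let P : ℝ[X] := (X ^ n * (X ^ (2 * m) - 1 - C ε)) ^ 2 - (C A * (X ^ (2 * m) - C ε)) ^ 2
  have hP : P ≠ 0 := by
    intro h0
    have := congrArg (eval 0) h0
    simp [P, hn, hm, hA, hε] at this
  refine (P.roots.toFinset.finite_toSet.biUnion (t := fun r => ((nthRoots n
    ((A * (r ^ (2 * m) - ε) / (r ^ (2 * m) - 1 - ε) : ℝ) : ℂ)).toFinset : Set ℂ))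
    fun r _ => Finset.finite_toSet _).subset ?_
  intro z hz
  have h := norm_eq_of_solution hz
  have hne : ‖z‖ ^ (2 * m) - 1 - ε ≠ 0 := by
    intro h0
    rw [h0, Complex.ofReal_zero, mul_zero, eq_comm, Complex.ofReal_eq_zero] at h
    rcases mul_eq_zero.1 h with h | h
    · exact hA h
    · linarith
  simp only [Set.mem_iUnion]
  refine ⟨‖z‖, ?_, ?_⟩
  · have h2 := congrArg (fun w : ℂ => ‖w‖ ^ 2) h
    simp only [norm_mul, norm_pow, Complex.norm_real, Real.norm_eq_abs, mul_pow, sq_abs] at h2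
    simp only [Finset.mem_coe, Multiset.mem_toFinset, mem_roots hP, IsRoot.def, P]
    simp only [eval_sub, eval_pow, eval_mul, eval_X, eval_C, eval_one]
    linear_combination h2
  · simp only [Finset.mem_coe, Multiset.mem_toFinset, mem_nthRoots (Nat.pos_of_ne_zero hn)]
    rw [Complex.ofReal_div, eq_div_iff (Complex.ofReal_ne_zero.2 hne), h]

theorem exists_three_radii {n m : ℕ} (hn : n ≠ 0) (hm : m ≠ 0) {A ε : ℝ} (hA : 0 < A)
    (hA1 : A < 1) (hε : 0 < ε) (hε1 : ε < 1) :
    ∃ r₁ r₂ r₃ : ℝ, 0 < r₁ ∧ r₁ < r₂ ∧ r₂ < r₃ ∧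
      1 * r₁ ^ n * (r₁ ^ (2 * m) - 1 - ε) = A * (r₁ ^ (2 * m) - ε) ∧
      -1 * r₂ ^ n * (r₂ ^ (2 * m) - 1 - ε) = A * (r₂ ^ (2 * m) - ε) ∧
      1 * r₃ ^ n * (r₃ ^ (2 * m) - 1 - ε) = A * (r₃ ^ (2 * m) - ε) := by
  have h2m : 2 * m ≠ 0 := by positivity
  obtain ⟨p, hp, hps⟩ : ∃ p : ℝ, 0 < p ∧ p ^ (2 * m) = ε :=
    ⟨ε ^ ((2 * m : ℕ) : ℝ)⁻¹, by positivity, Real.rpow_inv_natCast_pow hε.le h2m⟩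
  obtain ⟨q, hq, hqs⟩ : ∃ q : ℝ, 0 < q ∧ q ^ (2 * m) = 1 + ε :=
    ⟨(1 + ε) ^ ((2 * m : ℕ) : ℝ)⁻¹, by positivity,
      Real.rpow_inv_natCast_pow (by positivity) h2m⟩
  have hpq : p < q := lt_of_pow_lt_pow_left₀ (2 * m) hq.le (by linarith)
  have h4 : (4 : ℝ) ≤ 3 ^ (2 * m) := by
    rw [pow_mul]
    exact le_trans (by norm_num) (le_self_pow₀ (by norm_num : (1 : ℝ) ≤ 3 ^ 2) hm)
  have h3 : (3 : ℝ) ≤ 3 ^ n := le_self_pow₀ (by norm_num) hn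
  have hq3 : q < 3 := lt_of_pow_lt_pow_left₀ (2 * m) (by norm_num) (by linarith)
  have hpn : 0 < p ^ n := by positivity
  let f : ℝ → ℝ → ℝ := fun σ r => σ * r ^ n * (r ^ (2 * m) - 1 - ε) - A * (r ^ (2 * m) - ε)
  have hf : ∀ σ, Continuous (f σ) := fun σ => by fun_prop
  have hAε : 0 < A * ε := by positivity
  obtain ⟨r₁, h₁, e₁⟩ : (0 : ℝ) ∈ f 1 '' Set.Ioo 0 p := by
    refine intermediate_value_Ioo' hp.le (hf _).continuousOn ⟨?_, ?_⟩
    · simp only [f, hps]; linarith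
    · simp only [f, zero_pow hn, zero_pow h2m]; linarith
  obtain ⟨r₂, h₂, e₂⟩ : (0 : ℝ) ∈ f (-1) '' Set.Ioo p q := by
    refine intermediate_value_Ioo' hpq.le (hf _).continuousOn ⟨?_, ?_⟩
    · simp only [f, hqs]; linarith
    · simp only [f, hps]; linarith
  obtain ⟨r₃, h₃, e₃⟩ : (0 : ℝ) ∈ f 1 '' Set.Ioo q 3 := by
    refine intermediate_value_Ioo hq3.le (hf _).continuousOn ⟨?_, ?_⟩
    · simp only [f, hqs]; linarith
    · simp only [f]
      nlinarith [mul_nonneg (sub_nonneg.2 h3) (by linarith : (0 : ℝ) ≤ 3 ^ (2 * m) - 1 - ε),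
        mul_pos (sub_pos.2 hA1) (by linarith : (0 : ℝ) < 3 ^ (2 * m) - ε)]
  exact ⟨r₁, r₂, r₃, h₁.1, h₁.2.trans h₂.1, h₂.2.trans h₃.1,
    sub_eq_zero.1 e₁, sub_eq_zero.1 e₂, sub_eq_zero.1 e₃⟩


/-- For integers `2m ≥ n > m ≥ 1`, there exists `a₀ > 0` such that for every
`0 < a < a₀` there exists `ε₀ > 0` such that for every `0 < ε < ε₀`, the solution set of
the bifurcated lens equation is finite with at least `3n` elements. -/
theorem stmt_11 (n m : ℕ) (hm : 1 ≤ m) (hmn : m < n) (hn : n ≤ 2 * m) :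
    ∃ a₀ : ℝ, 0 < a₀ ∧ ∀ a : ℝ, 0 < a → a < a₀ →
      ∃ ε₀ : ℝ, 0 < ε₀ ∧ ∀ ε : ℝ, 0 < ε → ε < ε₀ →
        ({z : ℂ | z ^ m * (starRingEnd ℂ z) ^ m * (z ^ n - (a : ℂ) ^ n)
            = z ^ n + (ε : ℂ) * (z ^ n - (a : ℂ) ^ n)}).Finite ∧
        3 * n ≤ ({z : ℂ | z ^ m * (starRingEnd ℂ z) ^ m * (z ^ n - (a : ℂ) ^ n)
            = z ^ n + (ε : ℂ) * (z ^ n - (a : ℂ) ^ n)}).ncard := by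
  refine ⟨1, one_pos, fun a ha ha1 => ⟨1, one_pos, fun ε hε hε1 => ?_⟩⟩
  have hn0 : n ≠ 0 := by omega
  have hm0 : m ≠ 0 := by omega
  have hA : 0 < a ^ n := by positivity
  have hfin := finite_solutions hn0 hm0 hA.ne' hε.ne'
  rw [Complex.ofReal_pow] at hfin
  refine ⟨hfin, ?_⟩
  obtain ⟨r₁, r₂, r₃, h0, h12, h23, e₁, e₂, e₃⟩ :=
    exists_three_radii hn0 hm0 hA (pow_lt_one₀ ha.le ha1 hn0) hε hε1
  let F : ℝ → ℝ → Finset ℂ := fun σ r =>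
    (Polynomial.nthRoots n ((σ * r ^ n : ℝ) : ℂ)).toFinset
  have hcard : ∀ σ r : ℝ, σ ≠ 0 → 0 < r → (F σ r).card = n := fun σ r hσ hr =>
    card_nthRoots_toFinset_of_ne_zero hn0
      (Complex.ofReal_ne_zero.2 (mul_ne_zero hσ (pow_pos hr n).ne'))
  have hmem : ∀ {σ r : ℝ} {z : ℂ}, z ∈ F σ r → z ^ n = ((σ * r ^ n : ℝ) : ℂ) := fun hz => by
    simpa only [F, Multiset.mem_toFinset, Polynomial.mem_nthRoots (Nat.pos_of_ne_zero hn0)] using hz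
  have s₁ := fun z (hz : z ∈ F 1 r₁) => solution_of_radial hn0 h0.le (by simp) e₁ (hmem hz)
  have s₂ := fun z (hz : z ∈ F (-1) r₂) =>
    solution_of_radial hn0 (h0.trans h12).le (by simp) e₂ (hmem hz)
  have s₃ := fun z (hz : z ∈ F 1 r₃) =>
    solution_of_radial hn0 (h0.trans (h12.trans h23)).le (by simp) e₃ (hmem hz)
  have d₁₂ : Disjoint (F 1 r₁) (F (-1) r₂) := Finset.disjoint_left.2 fun z hz hz' =>
    h12.ne ((s₁ z hz).1.symm.trans (s₂ z hz').1)
  have d₃ : Disjoint (F 1 r₁ ∪ F (-1) r₂) (F 1 r₃) := Finset.disjoint_left.2 fun z hz hz' =>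
    (Finset.mem_union.1 hz).elim
      (fun hz => (h12.trans h23).ne ((s₁ z hz).1.symm.trans (s₃ z hz').1))
      fun hz => h23.ne ((s₂ z hz).1.symm.trans (s₃ z hz').1)
  have htotal : (F 1 r₁ ∪ F (-1) r₂ ∪ F 1 r₃).card = 3 * n := by
    rw [Finset.card_union_of_disjoint d₃, Finset.card_union_of_disjoint d₁₂,
      hcard _ _ one_ne_zero h0, hcard _ _ (by norm_num) (h0.trans h12),
      hcard _ _ one_ne_zero (h0.trans (h12.trans h23))]
    ring
  rw [← htotal, ← Set.ncard_coe_finset]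
  refine Set.ncard_le_ncard (fun z hz => ?_) hfin
  rw [Set.mem_ofPred_eq, ← Complex.ofReal_pow]
  rcases Finset.mem_union.1 (Finset.mem_coe.1 hz) with hz | hz
  · exact (Finset.mem_union.1 hz).elim (fun hz => (s₁ z hz).2) fun hz => (s₂ z hz).2
  · exact (s₃ z hz).2
end

section
/- Let n ≥ 1 and m ≥ 1 be integers, and let p, q be polynomials over ℂ with q monic of degree n, deg p ≤ n, and p(0) ≠ 0. Let g : ℂ → ℂ, g(z) = conj(z)·q(z) − p(z), and assume the zero set Z = {z ∈ ℂ | g(z) = 0} is finite of cardinality k, with every zero simple (i.e. at each α ∈ Z the Fréchet derivative of g over ℝ, as a real-linear map ℂ → ℂ, is invertible). Then there exists t₀ > 0 such that for every real t with 0 < t < t₀, the set {z ∈ ℂ | t · conj(z)^m · q(z) = conj(z)·q(z) − p(z)} is finite and has exactly k + m − 1 elements. -/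
open Filter Topology Set

section Persistence

variable {P E F : Type*} [NormedAddCommGroup P] [NormedSpace ℝ P] [CompleteSpace P]
  [NormedAddCommGroup E] [NormedSpace ℝ E] [CompleteSpace E]
  [NormedAddCommGroup F] [NormedSpace ℝ F] [CompleteSpace F]

/-- A simple zero of a member of a `C¹` family persists, locally uniquely, under perturbation. -/
theorem exists_isOpen_eventually_existsUnique_zero {f : P × E → F} (hf : ContDiff ℝ 1 f)
    {x₀ : P} {y₀ : E} (h₀ : f (x₀, y₀) = 0)
    (hbij : Function.Bijective (fderiv ℝ (fun y => f (x₀, y)) y₀))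
    {V : Set E} (hV : V ∈ 𝓝 y₀) :
    ∃ U ⊆ V, IsOpen U ∧ y₀ ∈ U ∧ ∀ᶠ x in 𝓝 x₀, ∃! y, y ∈ U ∧ f (x, y) = 0 := by
  have hd : HasStrictFDerivAt f (fderiv ℝ f (x₀, y₀)) (x₀, y₀) :=
    hf.contDiffAt.hasStrictFDerivAt one_ne_zero
  have hpart : fderiv ℝ (fun y => f (x₀, y)) y₀ =
      fderiv ℝ f (x₀, y₀) ∘L ContinuousLinearMap.inr ℝ P E :=
    (hd.hasFDerivAt.comp y₀ (hasFDerivAt_prodMk_right x₀ y₀)).fderiv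
  have hinv : (fderiv ℝ f (x₀, y₀) ∘L ContinuousLinearMap.inr ℝ P E).IsInvertible := by
    rw [← hpart]
    exact ⟨ContinuousLinearEquiv.ofBijective _ (LinearMap.ker_eq_bot.2 hbij.1)
      (LinearMap.range_eq_top.2 hbij.2), by ext; simp⟩
  have hiff := hd.eventually_apply_eq_iff_implicitFunctionOfProdDomain hinv
  have hlim := hd.tendsto_implicitFunctionOfProdDomain hinv
  set ψ := hd.implicitFunctionOfProdDomain hinv
  rw [h₀, nhds_prod_eq, eventually_prod_iff] at hiff
  obtain ⟨A, hA, B, hB, hAB⟩ := hiff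
  obtain ⟨U, hUsub, hUo, hyU⟩ := mem_nhds_iff.1 (inter_mem hV hB)
  refine ⟨U, fun y hy => (hUsub hy).1, hUo, hyU, ?_⟩
  filter_upwards [hA, hlim (hUo.mem_nhds hyU)] with x hx hψ
  exact ⟨ψ x, ⟨hψ, (hAB hx (hUsub hψ).2).2 rfl⟩,
    fun y hy => ((hAB hx (hUsub hy.1).2).1 hy.2).symm⟩

/-- If the zeros of `f (x₀, ·)` in a compact set are finitely many, simple and interior, then
their number does not change under a small `C¹` perturbation. -/
theorem eventually_ncard_zeros_eq {f : P × E → F} (hf : ContDiff ℝ 1 f) {x₀ : P} {K : Set E}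
    (hK : IsCompact K) (hfin : {y ∈ K | f (x₀, y) = 0}.Finite)
    (hint : ∀ y ∈ K, f (x₀, y) = 0 → y ∈ interior K)
    (hbij : ∀ y ∈ K, f (x₀, y) = 0 → Function.Bijective (fderiv ℝ (fun y => f (x₀, y)) y)) :
    ∀ᶠ x in 𝓝 x₀, {y ∈ K | f (x, y) = 0}.Finite ∧
      {y ∈ K | f (x, y) = 0}.ncard = {y ∈ K | f (x₀, y) = 0}.ncard := by
  set Z := {y ∈ K | f (x₀, y) = 0} with hZ
  obtain ⟨V, hV, hdisj⟩ := hfin.t2_separation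
  have hloc : ∀ α ∈ Z, ∃ U ⊆ V α ∩ interior K, IsOpen U ∧ α ∈ U ∧
      ∀ᶠ x in 𝓝 x₀, ∃! y, y ∈ U ∧ f (x, y) = 0 := fun α hα =>
    exists_isOpen_eventually_existsUnique_zero hf hα.2 (hbij α hα.1 hα.2)
      (inter_mem ((hV α).2.mem_nhds (hV α).1)
        (isOpen_interior.mem_nhds (hint α hα.1 hα.2)))
  choose! U hUsub hUo hαU hU using hloc
  have hout : ∀ᶠ x in 𝓝 x₀, ∀ y ∈ K \ ⋃ α ∈ Z, U α, f (x, y) ≠ 0 := by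
    apply (hK.diff (isOpen_biUnion hUo)).eventually_forall_of_forall_eventually
    rintro y ⟨hyK, hy⟩
    refine (hf.continuous.continuousAt.eventually_ne fun h0 => hy ?_)
    exact mem_biUnion (show y ∈ Z from ⟨hyK, h0⟩) (hαU y ⟨hyK, h0⟩)
  filter_upwards [hout, (eventually_all_finite hfin).2 hU] with x hx hxU
  choose! φ hφ hφu using hxU
  have hbij : BijOn φ Z {y ∈ K | f (x, y) = 0} := by
    refine ⟨fun α hα => ⟨interior_subset (hUsub α hα (hφ α hα).1).2, (hφ α hα).2⟩, ?_, ?_⟩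
    · intro α hα β hβ h
      by_contra hne
      exact disjoint_left.1 (hdisj hα hβ hne) (hUsub α hα (hφ α hα).1).1
        (h ▸ (hUsub β hβ (hφ β hβ).1).1)
    · rintro y ⟨hyK, hy⟩
      by_cases hyU : y ∈ ⋃ α ∈ Z, U α
      · obtain ⟨α, hα, hyα⟩ := mem_iUnion₂.1 hyU
        exact ⟨α, hα, (hφu α hα y ⟨hyα, hy⟩).symm⟩
      · exact absurd hy (hx y ⟨hyK, hyU⟩)
  rw [← hbij.image_eq]
  exact ⟨hfin.image φ, hbij.injOn.ncard_image⟩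

end Persistence

namespace Polynomial

/-- The homogenization `ε ^ n * p (v / ε)` of a polynomial `p` of degree at most `n`. -/
noncomputable def homogeneousEval (n : ℕ) (p : Polynomial ℂ) (ε : ℝ) (v : ℂ) : ℂ :=
  ∑ i ∈ Finset.range (n + 1), p.coeff i * (ε : ℂ) ^ (n - i) * v ^ i

theorem homogeneousEval_of_ne_zero {n : ℕ} {p : Polynomial ℂ} (hp : p.natDegree ≤ n) {ε : ℝ}
    (hε : ε ≠ 0) (v : ℂ) : p.homogeneousEval n ε v = (ε : ℂ) ^ n * p.eval (v / ε) := by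
  have hε' : (ε : ℂ) ≠ 0 := Complex.ofReal_ne_zero.2 hε
  rw [homogeneousEval, eval_eq_sum_range' (Nat.lt_succ_of_le hp), Finset.mul_sum]
  refine Finset.sum_congr rfl fun i hi => ?_
  have hin : i ≤ n := Nat.lt_succ_iff.1 (Finset.mem_range.1 hi)
  rw [pow_sub₀ _ hε' hin, div_pow]
  ring

theorem homogeneousEval_zero (n : ℕ) (p : Polynomial ℂ) (v : ℂ) :
    p.homogeneousEval n 0 v = p.coeff n * v ^ n := by
  rw [homogeneousEval, Finset.sum_eq_single_of_mem n (Finset.self_mem_range_succ n)]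
  · simp
  · intro i hi hne
    have : n - i ≠ 0 := by have := Finset.mem_range.1 hi; omega
    simp [this]

theorem contDiff_homogeneousEval (n : ℕ) (p : Polynomial ℂ) :
    ContDiff ℝ 1 fun x : ℝ × ℂ => p.homogeneousEval n x.1 x.2 := by
  have h1 : ContDiff ℝ 1 fun x : ℝ × ℂ => (x.1 : ℂ) :=
    Complex.ofRealCLM.contDiff.comp contDiff_fst
  unfold homogeneousEval
  fun_prop

theorem contDiff_real_eval (p : Polynomial ℂ) : ContDiff ℝ 1 fun z : ℂ => p.eval z := by
  have h : ContDiff ℂ 1 fun z : ℂ => p.eval z := by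
    simpa using p.contDiff_aeval (𝕜 := ℂ) (R := ℂ) 1
  exact h.restrict_scalars ℝ

end Polynomial

open scoped ComplexConjugate

/-- The harmonically splitting lens type polynomial `t conj(z)^m q(z) - (conj(z) q(z) - p(z))`. -/
noncomputable def lensPerturbation (m : ℕ) (p q : Polynomial ℂ) (x : ℝ × ℂ) : ℂ :=
  (x.1 : ℂ) * conj x.2 ^ m * q.eval x.2 - (conj x.2 * q.eval x.2 - p.eval x.2)

/-- The rescaling `ε ^ (n + 1) * lensPerturbation m p q (ε ^ (m - 1), v / ε)`, written so that it
extends smoothly to `ε = 0`. -/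
noncomputable def rescaledPerturbation (n m : ℕ) (p q : Polynomial ℂ) (x : ℝ × ℂ) : ℂ :=
  (conj x.2 ^ m - conj x.2) * q.homogeneousEval n x.1 x.2 + x.1 * p.homogeneousEval n x.1 x.2

theorem contDiff_conj_snd : ContDiff ℝ 1 fun x : ℝ × ℂ => conj x.2 :=
  Complex.conjCLE.contDiff.comp contDiff_snd

theorem contDiff_ofReal_fst : ContDiff ℝ 1 fun x : ℝ × ℂ => (x.1 : ℂ) :=
  Complex.ofRealCLM.contDiff.comp contDiff_fst

theorem contDiff_lensPerturbation (m : ℕ) (p q : Polynomial ℂ) :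
    ContDiff ℝ 1 (lensPerturbation m p q) := by
  have h1 := contDiff_conj_snd
  have h2 := contDiff_ofReal_fst
  have hp := p.contDiff_real_eval.comp (contDiff_snd (𝕜 := ℝ) (E := ℝ) (F := ℂ))
  have hq := q.contDiff_real_eval.comp (contDiff_snd (𝕜 := ℝ) (E := ℝ) (F := ℂ))
  exact ((h2.mul (h1.pow m)).mul hq).sub ((h1.mul hq).sub hp)

theorem contDiff_rescaledPerturbation (n m : ℕ) (p q : Polynomial ℂ) :
    ContDiff ℝ 1 (rescaledPerturbation n m p q) := by
  have h1 := contDiff_conj_snd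
  exact (((h1.pow m).sub h1).mul (q.contDiff_homogeneousEval n)).add
    (contDiff_ofReal_fst.mul (p.contDiff_homogeneousEval n))

theorem rescaledPerturbation_eq {n m : ℕ} (hm : 1 ≤ m) {p q : Polynomial ℂ}
    (hp : p.natDegree ≤ n) (hq : q.natDegree ≤ n) {ε : ℝ} (hε : ε ≠ 0) (v : ℂ) :
    rescaledPerturbation n m p q (ε, v) =
      (ε : ℂ) ^ (n + 1) * lensPerturbation m p q (ε ^ (m - 1), v / ε) := by
  have hε' : (ε : ℂ) ≠ 0 := Complex.ofReal_ne_zero.2 hε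
  obtain ⟨l, rfl⟩ := Nat.exists_eq_add_of_le' hm
  simp only [rescaledPerturbation, lensPerturbation, Polynomial.homogeneousEval_of_ne_zero hp hε,
    Polynomial.homogeneousEval_of_ne_zero hq hε, map_div₀, Complex.conj_ofReal, div_pow,
    Nat.add_sub_cancel, Complex.ofReal_pow]
  field_simp
  ring

theorem rescaledPerturbation_zero {n : ℕ} (m : ℕ) (p : Polynomial ℂ) {q : Polynomial ℂ}
    (hq : q.Monic) (hqdeg : q.natDegree = n) (v : ℂ) :
    rescaledPerturbation n m p q (0, v) = (conj v ^ m - conj v) * v ^ n := by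
  have : q.coeff n = 1 := hqdeg ▸ hq.coeff_natDegree
  simp [rescaledPerturbation, Polynomial.homogeneousEval_zero, this]

theorem rescaledPerturbation_zero_eq_zero_iff {n m : ℕ} (hm : 1 ≤ m) (p : Polynomial ℂ)
    {q : Polynomial ℂ} (hq : q.Monic) (hqdeg : q.natDegree = n) {v : ℂ} (hv : v ≠ 0) :
    rescaledPerturbation n m p q (0, v) = 0 ↔ v ^ (m - 1) = 1 := by
  obtain ⟨l, rfl⟩ := Nat.exists_eq_add_of_le' hm
  have hv' : conj v ≠ 0 := by simpa using hv
  rw [rescaledPerturbation_zero _ p hq hqdeg, mul_eq_zero, or_iff_left (pow_ne_zero n hv),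
    show conj v ^ (l + 1) - conj v = conj (v ^ l - 1) * conj v by simp; ring,
    mul_eq_zero, or_iff_left hv', map_eq_zero, sub_eq_zero, Nat.add_sub_cancel]

theorem bijective_of_forall_eq_zero (L : ℂ →L[ℝ] ℂ) (hL : ∀ h, L h = 0 → h = 0) :
    Function.Bijective L :=
  have hinj : Function.Injective L := (injective_iff_map_eq_zero L).2 hL
  ⟨hinj, (LinearMap.injective_iff_surjective (f := (L : ℂ →ₗ[ℝ] ℂ))).1 hinj⟩

theorem bijective_fderiv_rescaledPerturbation {n m : ℕ} (hm : 2 ≤ m) (p : Polynomial ℂ)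
    {q : Polynomial ℂ} (hq : q.Monic) (hqdeg : q.natDegree = n) {v : ℂ} (hv : v ^ (m - 1) = 1) :
    Function.Bijective (fderiv ℝ (fun v => rescaledPerturbation n m p q (0, v)) v) := by
  have hv0 : v ≠ 0 := by
    rintro rfl
    rw [zero_pow (by omega)] at hv
    exact zero_ne_one hv
  have hcv : conj v ^ (m - 1) = 1 := by rw [← map_pow, hv, map_one]
  have hc : HasFDerivAt (fun v : ℂ => conj v) (Complex.conjCLE : ℂ →L[ℝ] ℂ) v :=
    Complex.conjCLE.hasFDerivAt
  have hd : HasFDerivAt (fun v : ℂ => (conj v ^ m - conj v) * v ^ n) _ v :=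
    ((hc.pow m).sub hc).mul ((hasFDerivAt_id (𝕜 := ℝ) v).pow n)
  have hu : conj v ^ m - conj v = 0 := by
    rw [← Nat.sub_add_cancel (show 1 ≤ m by omega), pow_succ, hcv]; simp
  have hm1 : (m : ℂ) - 1 ≠ 0 := by
    rw [sub_ne_zero]; exact_mod_cast (by omega : m ≠ 1)
  rw [funext (rescaledPerturbation_zero m p hq hqdeg), hd.fderiv]
  refine bijective_of_forall_eq_zero _ fun h hh => ?_
  have hh' : v ^ n * (((m : ℂ) - 1) * conj h) = 0 := by
    rw [← hh]
    simp [hu, hcv, hv0]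
    ring
  simpa [hv0, hm1] using hh'

theorem ncard_setOf_pow_eq_one {l : ℕ} (hl : l ≠ 0) :
    {v : ℂ | v ^ l = 1}.Finite ∧ {v : ℂ | v ^ l = 1}.ncard = l := by
  have h : {v : ℂ | v ^ l = 1} = ↑(Polynomial.nthRootsFinset l (1 : ℂ)) := by
    ext v
    simp [Polynomial.mem_nthRootsFinset (Nat.pos_of_ne_zero hl)]
  rw [h, ncard_coe_finset]
  exact ⟨Finset.finite_toSet _, (Complex.isPrimitiveRoot_exp l hl).card_nthRootsFinset⟩

/-- Near infinity the zeros of the perturbation are those of the rescaled equation, which for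
`ε = 0` reduces to `v ^ (m - 1) = 1`. -/
theorem eventually_ncard_rescaledPerturbation {n m : ℕ} (hm : 2 ≤ m) (p : Polynomial ℂ)
    {q : Polynomial ℂ} (hq : q.Monic) (hqdeg : q.natDegree = n) :
    ∀ᶠ ε : ℝ in 𝓝 0,
      {v ∈ {v : ℂ | ‖v‖ ∈ Icc (1 / 4) 2} | rescaledPerturbation n m p q (ε, v) = 0}.Finite ∧
      {v ∈ {v : ℂ | ‖v‖ ∈ Icc (1 / 4) 2} | rescaledPerturbation n m p q (ε, v) = 0}.ncard =
        m - 1 := by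
  have hl : m - 1 ≠ 0 := by omega
  have hne : ∀ v : ℂ, ‖v‖ ∈ Icc (1 / 4 : ℝ) 2 → v ≠ 0 := by
    rintro v hv rfl
    norm_num at hv
  have hroot : ∀ v : ℂ, ‖v‖ ∈ Icc (1 / 4 : ℝ) 2 → rescaledPerturbation n m p q (0, v) = 0 →
      v ^ (m - 1) = 1 := fun v hv =>
    (rescaledPerturbation_zero_eq_zero_iff (by omega) p hq hqdeg (hne v hv)).1
  have hset : {v ∈ {v : ℂ | ‖v‖ ∈ Icc (1 / 4) 2} | rescaledPerturbation n m p q (0, v) = 0} =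
      {v : ℂ | v ^ (m - 1) = 1} := by
    ext v
    refine ⟨fun h => hroot v h.1 h.2, fun h => ?_⟩
    have hv : ‖v‖ ∈ Icc (1 / 4 : ℝ) 2 := by
      rw [Complex.norm_eq_one_of_pow_eq_one h hl]; norm_num
    exact ⟨hv, (rescaledPerturbation_zero_eq_zero_iff (by omega) p hq hqdeg (hne v hv)).2 h⟩
  have hcompact : IsCompact {v : ℂ | ‖v‖ ∈ Icc (1 / 4 : ℝ) 2} :=
    (isCompact_closedBall (0 : ℂ) 2).of_isClosed_subset (isClosed_Icc.preimage continuous_norm)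
      fun v hv => by simpa using hv.2
  have key := eventually_ncard_zeros_eq (contDiff_rescaledPerturbation n m p q) (x₀ := 0) hcompact
    (by rw [hset]; exact (ncard_setOf_pow_eq_one hl).1)
    (fun v hv h0 => by
      refine mem_interior.2 ⟨{v : ℂ | ‖v‖ ∈ Ioo (1 / 4 : ℝ) 2},
        fun w hw => Ioo_subset_Icc_self hw, isOpen_Ioo.preimage continuous_norm, ?_⟩
      show ‖v‖ ∈ Ioo (1 / 4 : ℝ) 2
      rw [Complex.norm_eq_one_of_pow_eq_one (hroot v hv h0) hl]; norm_num)
    (fun v hv h0 => bijective_fderiv_rescaledPerturbation hm p hq hqdeg (hroot v hv h0))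
  rwa [hset, (ncard_setOf_pow_eq_one hl).2] at key

theorem exists_radius_norm_eval_le {p q : Polynomial ℂ} (hq : 0 < q.natDegree)
    (hpq : p.natDegree ≤ q.natDegree) :
    ∃ R : ℝ, 0 < R ∧ ∀ z : ℂ, R ≤ ‖z‖ →
      ‖p.eval z‖ ≤ 1 / 4 * (‖z‖ * ‖q.eval z‖) ∧ q.eval z ≠ 0 := by
  have hq0 : q ≠ 0 := by rintro rfl; simp at hq
  have hdeg : p.degree < (Polynomial.X * q).degree := by
    apply Polynomial.degree_lt_degree
    rw [Polynomial.natDegree_X_mul hq0]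
    omega
  have h1 := (Polynomial.isLittleO_cobounded_of_degree_lt hdeg).bound
    (show (0 : ℝ) < 1 / 4 by norm_num)
  have h2 := (q.tendsto_norm_atTop (Polynomial.natDegree_pos_iff_degree_pos.1 hq)
    tendsto_norm_cobounded_atTop).eventually_gt_atTop 0
  obtain ⟨R, hR⟩ := (Filter.hasBasis_cobounded_norm.eventually_iff).1 (h1.and h2)
  refine ⟨max R 1, by positivity, fun z hz => ?_⟩
  obtain ⟨ha, hb⟩ := hR.2 (le_trans (le_max_left _ _) hz)
  exact ⟨by simpa using ha, norm_pos_iff.1 hb⟩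

/-- Zeros of the perturbation away from the origin have modulus comparable to
`t ^ (-1 / (m - 1))`. -/
theorem mul_norm_pow_mem_Icc {m : ℕ} (hm : 1 ≤ m) {p q : Polynomial ℂ} {t : ℝ} (ht : 0 < t)
    {z : ℂ} (hz : z ≠ 0) (hp : ‖p.eval z‖ ≤ 1 / 4 * (‖z‖ * ‖q.eval z‖)) (hq : q.eval z ≠ 0)
    (h0 : lensPerturbation m p q (t, z) = 0) :
    t * ‖z‖ ^ (m - 1) ∈ Icc (3 / 4 : ℝ) (5 / 4) := by
  obtain ⟨l, rfl⟩ := Nat.exists_eq_add_of_le' hm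
  rw [Nat.add_sub_cancel]
  have h : conj z * q.eval z * (t * conj z ^ l - 1) = - p.eval z := by
    simp only [lensPerturbation] at h0
    linear_combination h0
  have hpos : 0 < ‖z‖ * ‖q.eval z‖ := mul_pos (norm_pos_iff.2 hz) (norm_pos_iff.2 hq)
  have hn : ‖(t : ℂ) * conj z ^ l - 1‖ ≤ 1 / 4 := by
    have := congrArg norm h
    rw [norm_mul, norm_mul, norm_neg, RCLike.norm_conj] at this
    rw [← this, mul_comm (1 / 4)] at hp
    exact le_of_mul_le_mul_left hp hpos
  have hnorm : ‖(t : ℂ) * conj z ^ l‖ = t * ‖z‖ ^ l := by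
    simp [abs_of_pos ht]
  have hab := (abs_le.1 ((abs_norm_sub_norm_le ((t : ℂ) * conj z ^ l) 1).trans hn))
  rw [hnorm, norm_one] at hab
  constructor <;> linarith [hab.1, hab.2]

theorem mem_Icc_of_pow_mem_Icc {l : ℕ} (hl : l ≠ 0) {x : ℝ} (hx : 0 ≤ x)
    (h : x ^ l ∈ Icc (3 / 4 : ℝ) (5 / 4)) : x ∈ Icc (1 / 4 : ℝ) 2 := by
  constructor
  · by_contra! hlt
    linarith [h.1, pow_le_of_le_one hx (by linarith) hl]
  · by_contra! hlt
    linarith [h.2, le_self_pow₀ (by linarith : 1 ≤ x) hl]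

theorem eventually_ncard_lensPerturbation_outside {n m : ℕ} (hm : 1 ≤ m) {p q : Polynomial ℂ}
    (hq : q.Monic) (hqdeg : q.natDegree = n) (hpdeg : p.natDegree ≤ n) {R : ℝ} (hR : 0 < R)
    (hbound : ∀ z : ℂ, R ≤ ‖z‖ →
      ‖p.eval z‖ ≤ 1 / 4 * (‖z‖ * ‖q.eval z‖) ∧ q.eval z ≠ 0) :
    ∀ᶠ t in 𝓝[>] (0 : ℝ), {z : ℂ | R < ‖z‖ ∧ lensPerturbation m p q (t, z) = 0}.Finite ∧
      {z : ℂ | R < ‖z‖ ∧ lensPerturbation m p q (t, z) = 0}.ncard = m - 1 := by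
  have hmem : ∀ {t : ℝ} {z : ℂ}, 0 < t → R < ‖z‖ → lensPerturbation m p q (t, z) = 0 →
      t * ‖z‖ ^ (m - 1) ∈ Icc (3 / 4 : ℝ) (5 / 4) := fun ht hz h0 =>
    mul_norm_pow_mem_Icc hm ht (norm_pos_iff.1 (hR.trans hz)) (hbound _ hz.le).1
      (hbound _ hz.le).2 h0
  obtain rfl | hm2 : m = 1 ∨ 2 ≤ m := by omega
  · filter_upwards [Ioo_mem_nhdsGT (show (0 : ℝ) < 1 / 2 by norm_num)] with t ht
    have : {z : ℂ | R < ‖z‖ ∧ lensPerturbation 1 p q (t, z) = 0} = ∅ := by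
      refine eq_empty_of_forall_notMem fun z hz => ?_
      have := (hmem ht.1 hz.1 hz.2).1
      norm_num at this
      linarith [ht.2]
    simp [this]
  have hl : m - 1 ≠ 0 := by omega
  have hlim : Tendsto (fun t : ℝ => t ^ ((m - 1 : ℕ) : ℝ)⁻¹) (𝓝[>] 0) (𝓝 0) := by
    have hpos : (0 : ℝ) < ((m - 1 : ℕ) : ℝ)⁻¹ := by positivity
    have := (Real.continuousAt_rpow_const 0 _ (Or.inr hpos.le)).tendsto
    rw [Real.zero_rpow hpos.ne'] at this
    exact this.mono_left nhdsWithin_le_nhds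
  filter_upwards [self_mem_nhdsWithin,
    hlim.eventually (eventually_ncard_rescaledPerturbation hm2 p hq hqdeg),
    hlim.eventually (gt_mem_nhds (show 0 < 1 / (4 * R) by positivity))] with t ht hcard hsmall
  have ht : 0 < t := ht
  have hεpos : 0 < t ^ ((m - 1 : ℕ) : ℝ)⁻¹ := Real.rpow_pos_of_pos ht _
  have hεpow : (t ^ ((m - 1 : ℕ) : ℝ)⁻¹) ^ (m - 1) = t := Real.rpow_inv_natCast_pow ht.le hl
  set ε := t ^ ((m - 1 : ℕ) : ℝ)⁻¹
  have hε' : (ε : ℂ) ≠ 0 := Complex.ofReal_ne_zero.2 hεpos.ne'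
  have hiff : ∀ v : ℂ, rescaledPerturbation n m p q (ε, v) = 0 ↔
      lensPerturbation m p q (t, v / ε) = 0 := fun v => by
    rw [rescaledPerturbation_eq hm hpdeg hqdeg.le hεpos.ne', hεpow, mul_eq_zero,
      or_iff_right (pow_ne_zero _ hε')]
  have himage : (fun v : ℂ => v / ε) ''
      {v ∈ {v : ℂ | ‖v‖ ∈ Icc (1 / 4) 2} | rescaledPerturbation n m p q (ε, v) = 0} =
      {z : ℂ | R < ‖z‖ ∧ lensPerturbation m p q (t, z) = 0} := by
    apply Subset.antisymm
    · rintro _ ⟨v, ⟨hv, h0⟩, rfl⟩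
      refine ⟨?_, (hiff v).1 h0⟩
      have hv1 : 1 / 4 ≤ ‖v‖ := hv.1
      rw [norm_div, Complex.norm_of_nonneg hεpos.le, lt_div_iff₀ hεpos]
      rw [lt_div_iff₀ (by positivity)] at hsmall
      linarith
    · rintro z ⟨hz, h0⟩
      have hcancel : (ε : ℂ) * z / ε = z := mul_div_cancel_left₀ z hε'
      refine ⟨ε * z, ⟨?_, (hiff _).2 (hcancel.symm ▸ h0)⟩, hcancel⟩
      refine mem_Icc_of_pow_mem_Icc hl (norm_nonneg _) ?_
      rw [norm_mul, Complex.norm_of_nonneg hεpos.le, mul_pow, hεpow]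
      exact hmem ht hz h0
  have hinj : Function.Injective fun v : ℂ => v / ε := fun _ _ h => (div_left_inj' hε').1 h
  rw [← himage, ncard_image_of_injective _ hinj]
  exact ⟨hcard.1.image _, hcard.2⟩


/-- Let `q` be monic of degree `n`, `deg p ≤ n`, `p(0) ≠ 0`, and assume the
lens polynomial `g(z) = conj(z) q(z) - p(z)` has a finite zero set `Z` of cardinality `k`,
all zeros being simple (the real Fréchet derivative is invertible there). Then for all
sufficiently small `t > 0`, the harmonically splitting perturbation
`t conj(z)^m q(z) = conj(z) q(z) - p(z)` has exactly `k + m - 1` solutions. -/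
theorem stmt_12 (n m : ℕ) (hn : 1 ≤ n) (hm : 1 ≤ m) (p q : Polynomial ℂ)
    (hq : q.Monic) (hqdeg : q.natDegree = n) (hpdeg : p.natDegree ≤ n)
    (hp0 : p.eval 0 ≠ 0)
    (g : ℂ → ℂ) (hg : ∀ z, g z = (starRingEnd ℂ z) * q.eval z - p.eval z)
    (k : ℕ)
    (hZfin : ({z : ℂ | g z = 0}).Finite)
    (hZcard : ({z : ℂ | g z = 0}).ncard = k)
    (hsimple : ∀ α ∈ {z : ℂ | g z = 0}, Function.Bijective (fderiv ℝ g α)) :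
    ∃ t₀ : ℝ, 0 < t₀ ∧ ∀ t : ℝ, 0 < t → t < t₀ →
      ({z : ℂ | (t : ℂ) * (starRingEnd ℂ z) ^ m * q.eval z
          = (starRingEnd ℂ z) * q.eval z - p.eval z}).Finite ∧
      ({z : ℂ | (t : ℂ) * (starRingEnd ℂ z) ^ m * q.eval z
          = (starRingEnd ℂ z) * q.eval z - p.eval z}).ncard = k + m - 1 := by
  obtain ⟨R, hR, hbound⟩ := exists_radius_norm_eval_le (p := p) (q := q) (by omega) (by omega)
  have hg0 : (fun z => lensPerturbation m p q (0, z)) = fun z => -g z := by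
    funext z
    simp [lensPerturbation, hg]
  have hzero : ∀ z, lensPerturbation m p q (0, z) = 0 ↔ g z = 0 := fun z => by
    rw [congrFun hg0 z, neg_eq_zero]
  have hlt : ∀ z, g z = 0 → ‖z‖ < R := by
    intro z hz
    by_contra! hle
    obtain ⟨hp, hq0⟩ := hbound z hle
    rw [hg, sub_eq_zero] at hz
    rw [← hz, norm_mul, RCLike.norm_conj] at hp
    have : 0 < ‖z‖ * ‖q.eval z‖ := mul_pos (hR.trans_le hle) (norm_pos_iff.2 hq0)
    linarith
  have hset : {z ∈ Metric.closedBall (0 : ℂ) R | lensPerturbation m p q (0, z) = 0} =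
      {z | g z = 0} := by
    ext z
    exact ⟨fun h => (hzero z).1 h.2,
      fun h => ⟨mem_closedBall_zero_iff.2 (hlt z h).le, (hzero z).2 h⟩⟩
  have hin := eventually_ncard_zeros_eq (contDiff_lensPerturbation m p q) (x₀ := 0)
    (isCompact_closedBall (0 : ℂ) R) (hset ▸ hZfin)
    (fun z _ h0 => Metric.ball_subset_interior_closedBall
      (mem_ball_zero_iff.2 (hlt z ((hzero z).1 h0))))
    (fun z _ h0 => by
      rw [hg0, fderiv_fun_neg]
      exact (Equiv.neg ℂ).bijective.comp (hsimple z ((hzero z).1 h0)))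
  rw [hset, hZcard] at hin
  have hout := eventually_ncard_lensPerturbation_outside hm hq hqdeg hpdeg hR hbound
  obtain ⟨t₀, ht₀, hsub⟩ := mem_nhdsGT_iff_exists_Ioo_subset.1
    ((hin.filter_mono nhdsWithin_le_nhds).and hout)
  refine ⟨t₀, ht₀, fun t h0 h1 => ?_⟩
  obtain ⟨⟨hfin₁, hcard₁⟩, hfin₂, hcard₂⟩ := hsub ⟨h0, h1⟩
  have hunion : {z : ℂ | (t : ℂ) * (starRingEnd ℂ z) ^ m * q.eval z
      = (starRingEnd ℂ z) * q.eval z - p.eval z} =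
      {z ∈ Metric.closedBall (0 : ℂ) R | lensPerturbation m p q (t, z) = 0} ∪
      {z | R < ‖z‖ ∧ lensPerturbation m p q (t, z) = 0} := by
    ext z
    simp only [mem_ofPred_eq, mem_union, mem_closedBall_zero_iff, ← or_and_right, le_or_gt,
      true_and, lensPerturbation, sub_eq_zero]
  have hdisj : Disjoint {z ∈ Metric.closedBall (0 : ℂ) R | lensPerturbation m p q (t, z) = 0}
      {z | R < ‖z‖ ∧ lensPerturbation m p q (t, z) = 0} :=
    disjoint_left.2 fun z hz hz' => hz'.1.not_ge (mem_closedBall_zero_iff.1 hz.1)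
  rw [hunion, ncard_union_eq hdisj hfin₁ hfin₂, hcard₁, hcard₂]
  exact ⟨hfin₁.union hfin₂, by omega⟩
end
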